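/- Consider site percolation on ℤ² with parameter p satisfying p_c < p ≤ 1. Let M_n be the maximal number of pairwise vertex-disjoint open left-right crossings of the box {0,…,n} × {0,…,n} (each crossing being a path of adjacent open sites inside the box joining the column {0} × {0,…,n} to the column {n} × {0,…,n}). Then there exist constants C₅ = C₅(p) > 0 and C₆ = C₆(p) > 0 such that for all integers n ≥ 1, P_p(M_n ≤ C₅·n) ≤ exp(−C₆·n). -/

import Mathlib

open MeasureTheory
open scoped ENNReal

/-- Configurations of site percolation on `ℤ²`: `true` = open (black). -/
abbrev Config : Type := ℤ × ℤ → Bool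

/-- Two sites of `ℤ²` are adjacent iff `|v₁ − w₁| + |v₂ − w₂| = 1`. -/
def Adjacent (v w : ℤ × ℤ) : Prop := |v.1 - w.1| + |v.2 - w.2| = 1

/-- `OpenConn ω S v w` : there is a path of adjacent open sites staying in `S`
joining `v` to `w` (in the configuration `ω`). -/
def OpenConn (ω : Config) (S : Set (ℤ × ℤ)) : ℤ × ℤ → ℤ × ℤ → Prop :=
  Relation.ReflTransGen fun a b => Adjacent a b ∧ b ∈ S ∧ ω b = true

/-- The open cluster of the site `v` within the region `S`, in the configuration `ω`:
the set of open sites of `S` joined to `v` by a path of adjacent open sites staying in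
`S`. It is empty if `v` is closed or `v ∉ S`. -/
def cluster (ω : Config) (S : Set (ℤ × ℤ)) (v : ℤ × ℤ) : Set (ℤ × ℤ) :=
  {w | v ∈ S ∧ ω v = true ∧ OpenConn ω S v w}

/-- `IsBernoulliProduct p μ` : `μ` is the product measure on configurations under which
each site of `ℤ²` is independently open with probability `p`. -/
def IsBernoulliProduct (p : ℝ) (μ : Measure Config) : Prop :=
  IsProbabilityMeasure μ ∧
    ∀ (s : Finset (ℤ × ℤ)) (f : (ℤ × ℤ) → Bool),
      μ {ω | ∀ v ∈ s, ω v = f v} =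
        ∏ v ∈ s, ENNReal.ofReal (if f v then p else 1 - p)

/-- The critical probability `p_c` of site percolation on `ℤ²`:
`p_c = sSup {p ∈ [0,1] : P_p(|C(0,0)| = ∞) = 0}`. -/
noncomputable def siteCriticalProbability : ℝ :=
  sSup {p : ℝ | p ∈ Set.Icc (0 : ℝ) 1 ∧
    ∀ μ : Measure Config, IsBernoulliProduct p μ →
      μ {ω | (cluster ω Set.univ (0, 0)).Infinite} = 0}

/-- The `N × N` box `{1,…,N} × {1,…,N}` in `ℤ²` (the pixel screen). -/
def box (N : ℕ) : Set (ℤ × ℤ) :=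
  {v | 1 ≤ v.1 ∧ v.1 ≤ (N : ℤ) ∧ 1 ≤ v.2 ∧ v.2 ≤ (N : ℤ)}

/-- The box `{0,…,n} × {0,…,n}` in `ℤ²`. -/
def box0 (n : ℕ) : Set (ℤ × ℤ) :=
  {v | 0 ≤ v.1 ∧ v.1 ≤ (n : ℤ) ∧ 0 ≤ v.2 ∧ v.2 ≤ (n : ℤ)}

/-- `IsCrossing ω n P` : the nonempty list of sites `P` is an open left-right crossing of
the box `{0,…,n} × {0,…,n}` in the configuration `ω`: consecutive sites are adjacent, all
sites are open and lie in the box, the first site lies in the column `{0} × {0,…,n}` and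
the last site lies in the column `{n} × {0,…,n}`. -/
def IsCrossing (ω : Config) (n : ℕ) (P : List (ℤ × ℤ)) : Prop :=
  P ≠ [] ∧ P.Chain' Adjacent ∧ (∀ v ∈ P, v ∈ box0 n ∧ ω v = true) ∧
    (∃ hd, P.head? = some hd ∧ hd.1 = 0) ∧
    (∃ lst, P.getLast? = some lst ∧ lst.1 = (n : ℤ))

/-- `HasDisjointCrossings ω n k` : there exist `k` pairwise vertex-disjoint open left-right
crossings of the box `{0,…,n} × {0,…,n}` in the configuration `ω`. -/
def HasDisjointCrossings (ω : Config) (n k : ℕ) : Prop :=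
  ∃ P : Fin k → List (ℤ × ℤ), (∀ i, IsCrossing ω n (P i)) ∧
    ∀ i j, i ≠ j → ∀ v ∈ P i, v ∉ P j

namespace Perc

set_option linter.unusedSectionVars false

/-! ### Finite Bernoulli expectations -/

/-- Indicator of a proposition. -/
noncomputable def ind (Q : Prop) : ℝ := open Classical in if Q then 1 else 0

lemma ind_true {Q : Prop} (h : Q) : ind Q = 1 := by simp [ind, h]
lemma ind_false {Q : Prop} (h : ¬ Q) : ind Q = 0 := by simp [ind, h]
lemma ind_nonneg (Q : Prop) : 0 ≤ ind Q := by unfold ind; split_ifs <;> norm_num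
lemma ind_le_one (Q : Prop) : ind Q ≤ 1 := by unfold ind; split_ifs <;> norm_num
lemma ind_mono {Q Q' : Prop} (h : Q → Q') : ind Q ≤ ind Q' := by
  by_cases hq : Q
  · rw [ind_true hq, ind_true (h hq)]
  · rw [ind_false hq]; exact ind_nonneg _
lemma ind_and (Q Q' : Prop) : ind (Q ∧ Q') = ind Q * ind Q' := by
  by_cases hq : Q <;> by_cases hq' : Q' <;> simp [ind, hq, hq']
lemma ind_not (Q : Prop) : ind (¬ Q) = 1 - ind Q := by
  by_cases hq : Q <;> simp [ind, hq]
lemma ind_congr {Q Q' : Prop} (h : Q ↔ Q') : ind Q = ind Q' := by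
  by_cases hq : Q
  · rw [ind_true hq, ind_true (h.1 hq)]
  · rw [ind_false hq, ind_false (fun h' => hq (h.2 h'))]

variable {V : Type*} [DecidableEq V]

/-- Expectation of `F` when each site of `S` is occupied with probability `p`. -/
noncomputable def E (p : ℝ) (S : Finset V) (F : Set V → ℝ) : ℝ :=
  ∑ A ∈ S.powerset, p ^ A.card * (1 - p) ^ (S \ A).card * F (A : Set V)

/-- `F` depends only on the sites of `T`. -/
def Dep {α : Type*} (F : Set V → α) (T : Set V) : Prop := ∀ ω, F (ω ∩ T) = F ω

lemma Dep.congr {α : Type*} {F : Set V → α} {T : Set V} (h : Dep F T) {ω ω' : Set V}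
    (hh : ω ∩ T = ω' ∩ T) : F ω = F ω' := by rw [← h ω, hh, h]

lemma Dep.mono {α : Type*} {F : Set V → α} {T T' : Set V} (h : Dep F T) (hT : T ⊆ T') : Dep F T' := by
  intro ω
  apply h.congr
  ext v; simp only [Set.mem_inter_iff]; constructor
  · rintro ⟨⟨a, _⟩, b⟩; exact ⟨a, b⟩
  · rintro ⟨a, b⟩; exact ⟨⟨a, hT b⟩, b⟩

lemma Dep.ind {Q : Set V → Prop} {T : Set V} (h : Dep Q T) : Dep (fun ω => ind (Q ω)) T := by
  intro ω; simp only [h ω]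

lemma E_empty (p : ℝ) (F : Set V → ℝ) : E p ∅ F = F ∅ := by simp [E]

lemma E_insert (p : ℝ) {a : V} {S : Finset V} (ha : a ∉ S) (F : Set V → ℝ) :
    E p (insert a S) F = p * E p S (fun ω => F (insert a ω)) + (1 - p) * E p S F := by
  unfold E
  rw [Finset.sum_powerset_insert ha, add_comm, Finset.mul_sum, Finset.mul_sum]
  congr 1
  · apply Finset.sum_congr rfl
    intro A hA
    have hA' : a ∉ A := fun h => ha (Finset.mem_powerset.1 hA h)
    have h1 : insert a S \ insert a A = S \ A := by
      ext v; simp only [Finset.mem_sdiff, Finset.mem_insert]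
      constructor
      · rintro ⟨h1, h2⟩; tauto
      · rintro ⟨h1, h2⟩; refine ⟨Or.inr h1, ?_⟩; rintro (rfl | h); exacts [ha h1, h2 h]
    rw [Finset.card_insert_of_notMem hA', h1, Finset.coe_insert]; ring
  · apply Finset.sum_congr rfl
    intro A hA
    have hA' : a ∉ A := fun h => ha (Finset.mem_powerset.1 hA h)
    have h1 : insert a S \ A = insert a (S \ A) := Finset.insert_sdiff_of_notMem _ hA'
    rw [h1, Finset.card_insert_of_notMem (by simp [ha])]; ring

lemma E_congr (p : ℝ) (S : Finset V) {F G : Set V → ℝ} (h : ∀ ω, ω ⊆ ↑S → F ω = G ω) : E p S F = E p S G := by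
  apply Finset.sum_congr rfl
  intro A hA
  rw [h A (by exact_mod_cast Finset.mem_powerset.1 hA)]

lemma E_add (p : ℝ) (S : Finset V) (F G : Set V → ℝ) :
    E p S (fun ω => F ω + G ω) = E p S F + E p S G := by
  simp [E, mul_add, Finset.sum_add_distrib]

lemma E_sub (p : ℝ) (S : Finset V) (F G : Set V → ℝ) :
    E p S (fun ω => F ω - G ω) = E p S F - E p S G := by
  simp [E, mul_sub, Finset.sum_sub_distrib]

lemma E_mul_left (p : ℝ) (S : Finset V) (c : ℝ) (F : Set V → ℝ) :
    E p S (fun ω => c * F ω) = c * E p S F := by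
  simp only [E, Finset.mul_sum]; apply Finset.sum_congr rfl; intros; ring

lemma E_sum {ι : Type*} (p : ℝ) (S : Finset V) (I : Finset ι) (F : ι → Set V → ℝ) :
    E p S (fun ω => ∑ i ∈ I, F i ω) = ∑ i ∈ I, E p S (F i) := by
  simp only [E, Finset.mul_sum]; rw [Finset.sum_comm]

lemma E_const (p : ℝ) (S : Finset V) (c : ℝ) : E p S (fun _ => c) = c := by
  induction S using Finset.induction_on with
  | empty => simp [E_empty]
  | insert a S ha ih => rw [E_insert p ha, ih]; ring

lemma E_mono {p : ℝ} (h0 : 0 ≤ p) (h1 : p ≤ 1) (S : Finset V) {F G : Set V → ℝ}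
    (h : ∀ ω, ω ⊆ ↑S → F ω ≤ G ω) : E p S F ≤ E p S G := by
  apply Finset.sum_le_sum
  intro A hA
  apply mul_le_mul_of_nonneg_left (h A (by exact_mod_cast Finset.mem_powerset.1 hA))
  have : 0 ≤ 1 - p := by linarith
  positivity

lemma E_nonneg {p : ℝ} (h0 : 0 ≤ p) (h1 : p ≤ 1) (S : Finset V) {F : Set V → ℝ}
    (h : ∀ ω, 0 ≤ F ω) : 0 ≤ E p S F := by
  have := E_mono h0 h1 S (F := fun _ => 0) (G := F) (fun ω _ => h ω)
  rwa [E_const] at this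

lemma E_ind_le_one {p : ℝ} (h0 : 0 ≤ p) (h1 : p ≤ 1) (S : Finset V) (Q : Set V → Prop) :
    E p S (fun ω => ind (Q ω)) ≤ 1 := by
  have := E_mono h0 h1 S (F := fun ω => ind (Q ω)) (G := fun _ => 1) (fun ω _ => ind_le_one _)
  rwa [E_const] at this

lemma E_extend (p : ℝ) {a : V} {S : Finset V} (F : Set V → ℝ) (h : Dep F (↑S)) :
    E p (insert a S) F = E p S F := by
  by_cases ha : a ∈ S
  · rw [Finset.insert_eq_of_mem ha]
  · rw [E_insert p ha]
    have : E p S (fun ω => F (insert a ω)) = E p S F := by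
      apply E_congr; intro ω _
      apply h.congr
      ext v; simp only [Set.mem_inter_iff, Set.mem_insert_iff]
      constructor
      · rintro ⟨rfl | h, h'⟩; exacts [absurd h' ha, ⟨h, h'⟩]
      · rintro ⟨h, h'⟩; exact ⟨Or.inr h, h'⟩
    rw [this]; ring

lemma E_dep (p : ℝ) {S T : Finset V} (hTS : T ⊆ S) (F : Set V → ℝ) (h : Dep F (↑T)) :
    E p S F = E p T F := by
  rw [← Finset.union_sdiff_of_subset hTS]
  generalize S \ T = U
  induction U using Finset.induction_on with
  | empty => simp
  | insert a U ha ih =>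
    rw [Finset.union_insert, E_extend, ih]
    exact h.mono (by push_cast; exact Set.subset_union_left)

lemma E_mul_aux (p : ℝ) (S1 S2 : Finset V) (hd : Disjoint S1 S2) (F G : Set V → ℝ)
    (hF : Dep F (↑S1)) (hG : Dep G (↑S2)) :
    E p (S1 ∪ S2) (fun ω => F ω * G ω) = E p S1 F * E p S2 G := by
  induction S1 using Finset.induction_on generalizing F with
  | empty =>
    rw [Finset.empty_union, E_empty, ← E_mul_left]
    apply E_congr; intro ω _
    rw [← hF ω]; simp
  | insert a S ha ih =>
    have ha2 : a ∉ S2 := Finset.disjoint_left.1 hd (Finset.mem_insert_self a S)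
    have hd' : Disjoint S S2 := hd.mono_left (Finset.subset_insert a S)
    have key : ∀ (F' : Set V → ℝ), Dep F' (↑(insert a S)) → Dep (fun ω => F' (ω ∩ ↑S)) (↑S : Set V) := by
      intro F' _ ω; simp [Set.inter_assoc]
    have e1 : E p S (fun ω => F (insert a ω)) = E p S (fun ω => F (insert a (ω ∩ ↑S))) := by
      apply E_congr; intro ω hω; rw [Set.inter_eq_left.2 hω]
    have e2 : E p S F = E p S (fun ω => F (ω ∩ ↑S)) := by
      apply E_congr; intro ω hω; rw [Set.inter_eq_left.2 hω]
    rw [Finset.insert_union, E_insert p (by simp [ha, ha2]), E_insert p ha, e1, e2, add_mul, mul_assoc, mul_assoc,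
      ← ih hd' (fun ω => F (insert a (ω ∩ ↑S))) (by intro ω; simp [Set.inter_assoc]),
      ← ih hd' (fun ω => F (ω ∩ ↑S)) (by intro ω; simp [Set.inter_assoc])]
    congr 2
    · apply E_congr; intro ω hω
      congr 1
      · apply hF.congr
        ext v; simp only [Set.mem_inter_iff, Set.mem_insert_iff, Finset.coe_insert, Finset.mem_coe]; tauto
      · apply hG.congr
        ext v; simp only [Set.mem_inter_iff, Set.mem_insert_iff, Finset.mem_coe]
        constructor
        · rintro ⟨rfl | h, h'⟩; exacts [absurd h' ha2, ⟨h, h'⟩]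
        · rintro ⟨h, h'⟩; exact ⟨Or.inr h, h'⟩
    · apply E_congr; intro ω hω
      congr 1
      apply hF.congr
      ext v; simp only [Set.mem_inter_iff, Set.mem_insert_iff, Finset.coe_insert, Finset.mem_coe]
      constructor
      · rintro ⟨h, rfl | h'⟩
        · exfalso; have := hω h; simp [ha, ha2] at this
        · exact ⟨⟨h, h'⟩, Or.inr h'⟩
      · tauto

lemma E_mul (p : ℝ) {S S1 S2 : Finset V} (h1 : S1 ⊆ S) (h2 : S2 ⊆ S) (hd : Disjoint S1 S2) (F G : Set V → ℝ)
    (hF : Dep F (↑S1)) (hG : Dep G (↑S2)) :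
    E p S (fun ω => F ω * G ω) = E p S F * E p S G := by
  rw [E_dep p h1 F hF, E_dep p h2 G hG, ← E_mul_aux p S1 S2 hd F G hF hG]
  apply E_dep p (Finset.union_subset h1 h2)
  intro ω
  show F _ * G _ = F ω * G ω
  rw [(hF.mono (T' := ↑(S1 ∪ S2)) (by push_cast; exact Set.subset_union_left)) ω,
    (hG.mono (T' := ↑(S1 ∪ S2)) (by push_cast; exact Set.subset_union_right)) ω]

lemma E_split (p : ℝ) {a : V} {S : Finset V} (ha : a ∈ S) (F : Set V → ℝ) :
    E p S F = p * E p S (fun ω => F (insert a ω)) + (1 - p) * E p S (fun ω => F (ω \ {a})) := by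
  have h : a ∉ S.erase a := Finset.notMem_erase a S
  rw [← Finset.insert_erase ha, E_insert p h, E_insert p h, E_insert p h]
  have e : E p (S.erase a) (fun ω => F (ω \ {a})) = E p (S.erase a) F := by
    apply E_congr; intro ω hω
    rw [Set.sdiff_singleton_eq_self (fun h' => h (hω h'))]
  have e' : E p (S.erase a) (fun ω => F (insert a ω \ {a})) = E p (S.erase a) F := by
    apply E_congr; intro ω hω
    rw [Set.insert_sdiff_of_mem _ (Set.mem_singleton a), Set.sdiff_singleton_eq_self (fun h' => h (hω h'))]
  simp only [Set.insert_idem]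
  rw [e, e']; ring

/-- Russo's formula. -/
lemma E_russo (S : Finset V) (F : Set V → ℝ) (p : ℝ) :
    HasDerivAt (fun p => E p S F) (∑ v ∈ S, E p S (fun ω => F (insert v ω) - F (ω \ {v}))) p := by
  induction S using Finset.induction_on generalizing F with
  | empty => simp only [E_empty, Finset.sum_empty]; exact hasDerivAt_const _ _
  | insert a S ha ih =>
    have h1 : (fun p => E p (insert a S) F) =
      fun p => p * E p S (fun ω => F (insert a ω)) + (1 - p) * E p S F := by
      funext p; rw [E_insert p ha]
    rw [h1]
    have h2 := ((hasDerivAt_id p).mul (ih (fun ω => F (insert a ω)))).add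
      (((hasDerivAt_const p (1:ℝ)).sub (hasDerivAt_id p)).mul (ih F))
    refine h2.congr_deriv ?_
    rw [Finset.sum_insert ha, E_insert p ha]
    have e0 : ∀ ω : Set V, ω ⊆ ↑S → F (ω \ {a}) = F ω := by
      intro ω hω; rw [Set.sdiff_singleton_eq_self (fun h' => ha (hω h'))]
    have e1 : ∀ ω : Set V, ω ⊆ ↑S → F (insert a ω \ {a}) = F ω := by
      intro ω hω
      rw [Set.insert_sdiff_of_mem _ (Set.mem_singleton a), e0 ω hω]
    rw [E_congr p S (F := fun ω => F (insert a (insert a ω)) - F (insert a ω \ {a}))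
        (G := fun ω => F (insert a ω) - F ω) (fun ω hω => by rw [e1 ω hω, Set.insert_idem]),
      E_congr p S (F := fun ω => F (insert a ω) - F (ω \ {a})) (G := fun ω => F (insert a ω) - F ω)
        (fun ω hω => by rw [e0 ω hω])]
    have e3 : ∀ v ∈ S, E p (insert a S) (fun ω => F (insert v ω) - F (ω \ {v})) =
        p * E p S (fun ω => F (insert a (insert v ω)) - F (insert a (ω \ {v})))
        + (1 - p) * E p S (fun ω => F (insert v ω) - F (ω \ {v})) := by
      intro v hv
      rw [E_insert p ha]
      congr 2
      apply E_congr; intro ω hω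
      have hva : a ≠ v := fun h => ha (h ▸ hv)
      rw [Set.insert_comm, Set.insert_sdiff_of_notMem _ (by simpa using hva)]
    rw [Finset.sum_congr rfl e3, Finset.sum_add_distrib, ← Finset.mul_sum, ← Finset.mul_sum, E_sub]
    simp only [id_eq, Pi.sub_apply]
    ring

lemma harris {p : ℝ} (h0 : 0 ≤ p) (h1 : p ≤ 1) (S : Finset V) (F G : Set V → ℝ)
    (hF : Monotone F) (hG : Monotone G) :
    E p S F * E p S G ≤ E p S (fun ω => F ω * G ω) := by
  induction S using Finset.induction_on generalizing F G with
  | empty => simp [E_empty]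
  | insert a S ha ih =>
    rw [E_insert p ha, E_insert p ha, E_insert p ha]
    have mi : Monotone (fun ω : Set V => insert a ω) := fun _ _ h => Set.insert_subset_insert h
    have a1 := ih (fun ω => F (insert a ω)) (fun ω => G (insert a ω)) (hF.comp mi) (hG.comp mi)
    have a2 := ih F G hF hG
    have a3 : E p S F ≤ E p S (fun ω => F (insert a ω)) :=
      E_mono h0 h1 S (fun ω _ => hF (Set.subset_insert a ω))
    have a4 : E p S G ≤ E p S (fun ω => G (insert a ω)) :=
      E_mono h0 h1 S (fun ω _ => hG (Set.subset_insert a ω))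
    have b1 := mul_le_mul_of_nonneg_left a1 h0
    have b2 := mul_le_mul_of_nonneg_left a2 (sub_nonneg.2 h1)
    have b3 := mul_nonneg (mul_nonneg h0 (sub_nonneg.2 h1)) (mul_nonneg (sub_nonneg.2 a3) (sub_nonneg.2 a4))
    nlinarith

lemma harris_anti {p : ℝ} (h0 : 0 ≤ p) (h1 : p ≤ 1) (S : Finset V) (F G : Set V → ℝ)
    (hF : Antitone F) (hG : Antitone G) :
    E p S F * E p S G ≤ E p S (fun ω => F ω * G ω) := by
  have := harris h0 h1 S (fun ω => (-1) * F ω) (fun ω => (-1) * G ω)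
    (fun a b h => by have := hF h; simp only; linarith) (fun a b h => by have := hG h; simp only; linarith)
  rw [E_mul_left, E_mul_left] at this
  calc _ = (-1 * E p S F) * (-1 * E p S G) := by ring
    _ ≤ _ := this
    _ = _ := by apply E_congr; intros; ring

lemma E_coupling (p r : ℝ) (S : Finset V) (F : Set V → ℝ) :
    E (p * r) S F = E p S (fun ω => E r S (fun η => F (ω ∩ η))) := by
  induction S using Finset.induction_on generalizing F with
  | empty => simp [E_empty]
  | insert a S ha ih =>
    rw [E_insert _ ha, E_insert _ ha]
    have e1 : ∀ ω : Set V, ω ⊆ ↑S → E r (insert a S) (fun η => F (insert a ω ∩ η)) =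
      r * E r S (fun η => F (insert a (ω ∩ η))) + (1 - r) * E r S (fun η => F (ω ∩ η)) := by
      intro ω hω
      rw [E_insert _ ha]
      congr 2
      · apply E_congr; intro η _; rw [← Set.insert_inter_distrib]
      · apply E_congr; intro η hη
        rw [Set.insert_inter_of_notMem (fun h => ha (hη h))]
    have e2 : ∀ ω : Set V, ω ⊆ ↑S → E r (insert a S) (fun η => F (ω ∩ η)) = E r S (fun η => F (ω ∩ η)) := by
      intro ω hω
      rw [E_insert _ ha]
      have : E r S (fun η => F (ω ∩ insert a η)) = E r S (fun η => F (ω ∩ η)) := by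
        apply E_congr; intro η hη
        rw [Set.inter_insert_of_notMem (fun h => ha (hω h))]
      rw [this]; ring
    rw [E_congr p S e1, E_congr p S e2, E_add, E_mul_left, E_mul_left, ih F, ih (fun ω => F (insert a ω))]
    ring

lemma E_mono_p {p p' : ℝ} (h0 : 0 ≤ p) (h : p ≤ p') (h1 : p' ≤ 1) (S : Finset V) (F : Set V → ℝ)
    (hF : Monotone F) : E p S F ≤ E p' S F := by
  rcases eq_or_lt_of_le (h0.trans h) with h' | h'
  · have : p = p' := by linarith
    rw [this]
  · have hr : p = p' * (p / p') := by field_simp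
    rw [hr, E_coupling]
    have r0 : 0 ≤ p / p' := by positivity
    have r1 : p / p' ≤ 1 := by rw [div_le_one h']; exact h
    apply E_mono h'.le h1
    intro ω _
    have := E_mono r0 r1 S (F := fun η => F (ω ∩ η)) (G := fun _ => F ω) (fun η _ => hF Set.inter_subset_left)
    rwa [E_const] at this

lemma E_map (p : ℝ) (S : Finset V) (e : V ≃ V) (F : Set V → ℝ) :
    E p (S.map e.toEmbedding) F = E p S (fun ω => F (e '' ω)) := by
  induction S using Finset.induction_on generalizing F with
  | empty => simp [E_empty]
  | insert a S ha ih =>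
    rw [Finset.map_insert, E_insert _ (by simpa using ha), E_insert _ ha, ih, ih]
    simp only [Set.image_insert_eq, Equiv.coe_toEmbedding]

lemma E_compl_aux (p : ℝ) (S : Finset V) (F : Set V → ℝ) :
    E p S (fun ω => F (↑S \ ω)) = E (1 - p) S F := by
  induction S using Finset.induction_on generalizing F with
  | empty => simp [E_empty]
  | insert a S ha ih =>
    rw [E_insert _ ha, E_insert _ ha, ← ih, ← ih]
    have e1 : E p S (fun ω => F (↑(insert a S) \ insert a ω)) = E p S (fun ω => F (↑S \ ω)) := by
      apply E_congr; intro ω hω; congr 1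
      ext v; simp only [Finset.coe_insert, Set.mem_sdiff, Set.mem_insert_iff, Finset.mem_coe]
      constructor
      · tauto
      · rintro ⟨h, h'⟩; refine ⟨Or.inr h, ?_⟩; rintro (rfl | h''); exacts [ha h, h' h'']
    have e2 : E p S (fun ω => F (↑(insert a S) \ ω)) = E p S (fun ω => F (insert a (↑S \ ω))) := by
      apply E_congr; intro ω hω; congr 1
      ext v; simp only [Finset.coe_insert, Set.mem_sdiff, Set.mem_insert_iff, Finset.mem_coe]
      constructor
      · tauto
      · rintro (rfl | h)
        · exact ⟨Or.inl rfl, fun h => ha (hω h)⟩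
        · exact ⟨Or.inr h.1, h.2⟩
    rw [e1, e2]; ring

lemma E_compl (p : ℝ) (S : Finset V) (F : Set V → ℝ) (hF : Dep F (↑S)) :
    E p S (fun ω => F ωᶜ) = E (1 - p) S F := by
  rw [← E_compl_aux]
  apply E_congr; intro ω _; apply hF.congr
  ext v; simp; tauto

end Perc

namespace Perc

/-! ### Connectivity -/

variable {V : Type*}

/-- `u` and `v` are joined by an `R`-path inside `G`. -/
def Conn (R : V → V → Prop) (G : Set V) (u v : V) : Prop :=
  u ∈ G ∧ Relation.ReflTransGen (fun a b => R a b ∧ b ∈ G) u v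

variable {R : V → V → Prop} {G G' : Set V} {u v w : V}

lemma Conn.refl (h : u ∈ G) : Conn R G u u := ⟨h, Relation.ReflTransGen.refl⟩

lemma Conn.mem_left (h : Conn R G u v) : u ∈ G := h.1

lemma Conn.mem_right (h : Conn R G u v) : v ∈ G := by
  obtain ⟨h1, h2⟩ := h
  cases h2 with
  | refl => exact h1
  | tail _ h => exact h.2

lemma Conn.tail (h : Conn R G u v) (hr : R v w) (hw : w ∈ G) : Conn R G u w :=
  ⟨h.1, h.2.tail ⟨hr, hw⟩⟩

lemma Conn.trans (h : Conn R G u v) (h' : Conn R G v w) : Conn R G u w :=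
  ⟨h.1, h.2.trans h'.2⟩

lemma Conn.induct {P : V → Prop} (h : Conn R G u v) (h0 : P u)
    (hs : ∀ b c, Conn R G u b → R b c → c ∈ G → P b → P c) : P v := by
  obtain ⟨h1, h2⟩ := h
  induction h2 with
  | refl => exact h0
  | tail hab hbc ih => exact hs _ _ ⟨h1, hab⟩ hbc.1 hbc.2 ih

lemma Conn.mono (h : Conn R G u v) (hG : G ⊆ G') : Conn R G' u v :=
  h.induct (P := fun v => Conn R G' u v) (Conn.refl (hG h.1))
    (fun _ _ _ hr hc ih => ih.tail hr (hG hc))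

lemma Conn.monoR {R' : V → V → Prop} (h : Conn R G u v) (hR : ∀ a b, R a b → R' a b) : Conn R' G u v :=
  h.induct (P := fun v => Conn R' G u v) (Conn.refl h.1)
    (fun _ _ _ hr hc ih => ih.tail (hR _ _ hr) hc)

lemma Conn.symm (hR : ∀ a b, R a b → R b a) (h : Conn R G u v) : Conn R G v u :=
  h.induct (P := fun v => Conn R G v u) (Conn.refl h.1)
    (fun b _ hb hr hc ih => (Conn.tail (Conn.refl hc) (hR _ _ hr) hb.mem_right).trans ih)

lemma Conn.first_exit (h : Conn R G u v) (S : Set V) (hu : u ∈ S) :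
    Conn R (G ∩ S) u v ∨ ∃ a b, Conn R (G ∩ S) u a ∧ R a b ∧ b ∈ G ∧ b ∉ S := by
  apply h.induct (P := fun v => Conn R (G ∩ S) u v ∨ ∃ a b, Conn R (G ∩ S) u a ∧ R a b ∧ b ∈ G ∧ b ∉ S)
  · exact Or.inl (Conn.refl ⟨h.1, hu⟩)
  · rintro b c hb hr hc (ih | ih)
    · by_cases hcS : c ∈ S
      · exact Or.inl (ih.tail hr ⟨hc, hcS⟩)
      · exact Or.inr ⟨b, c, ih, hr, hc, hcS⟩
    · exact Or.inr ih

lemma Conn.last_exit (h : Conn R G u v) (S : Set V) (hu : u ∈ S) (hv : v ∉ S) :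
    ∃ a b, a ∈ S ∧ Conn R G u a ∧ R a b ∧ Conn R (G \ S) b v := by
  have : v ∈ S ∨ ∃ a b, a ∈ S ∧ Conn R G u a ∧ R a b ∧ Conn R (G \ S) b v := by
    apply h.induct (P := fun v => v ∈ S ∨ ∃ a b, a ∈ S ∧ Conn R G u a ∧ R a b ∧ Conn R (G \ S) b v)
    · exact Or.inl hu
    · intro b c hb hr hc ih
      by_cases hcS : c ∈ S
      · exact Or.inl hcS
      · right
        rcases ih with ih | ⟨a, b', ha, h1, h2, h3⟩
        · exact ⟨b, c, ih, hb, hr, Conn.refl ⟨hc, hcS⟩⟩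
        · exact ⟨a, b', ha, h1, h2, h3.tail hr ⟨hc, hcS⟩⟩
  exact this.resolve_left hv

lemma Conn.map (e : V → V) (he : ∀ a b, R a b → R (e a) (e b)) (h : Conn R G u v) :
    Conn R (e '' G) (e u) (e v) :=
  h.induct (P := fun v => Conn R (e '' G) (e u) (e v)) (Conn.refl ⟨u, h.1, rfl⟩)
    (fun _ c _ hr hc ih => ih.tail (he _ _ hr) ⟨c, hc, rfl⟩)

/-- The union of the clusters of the sources `B`. -/
def Cl (R : V → V → Prop) (G B : Set V) : Set V := {v | ∃ b ∈ B, Conn R G b v}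

/-- `t` with its closed boundary inside `L`, sources `B`. -/
def clo (R : V → V → Prop) (L B t : Set V) : Set V := t ∪ {v | v ∈ L ∧ (v ∈ B ∨ ∃ x ∈ t, R x v)}

lemma Cl_subset {B : Set V} : Cl R G B ⊆ G := by
  rintro v ⟨b, _, h⟩; exact h.mem_right

lemma Conn.in_Cl {B : Set V} {b : V} (hb : b ∈ B) (h : Conn R G b v) : Conn R (Cl R G B) b v :=
  h.induct (P := fun v => Conn R (Cl R G B) b v) (Conn.refl ⟨b, hb, Conn.refl h.1⟩)
    (fun _ c hx hr hc ih => ih.tail hr ⟨b, hb, hx.tail hr hc⟩)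

lemma Cl_closed {B : Set V} (h : v ∈ Cl R G B) (hr : R v w) (hw : w ∈ G) : w ∈ Cl R G B := by
  obtain ⟨b, hb, hc⟩ := h
  exact ⟨b, hb, hc.tail hr hw⟩

lemma Cl_dep_aux {L B t ω ω' : Set V} (h : ω ∩ clo R L B t = ω' ∩ clo R L B t) (ht : Cl R (ω ∩ L) B = t) :
    Cl R (ω' ∩ L) B = t := by
  have hin : ∀ v, v ∈ clo R L B t → (v ∈ ω ↔ v ∈ ω') := by
    intro v hv
    have := Set.ext_iff.1 h v
    simp only [Set.mem_inter_iff, hv, and_true] at this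
    exact this
  apply Set.Subset.antisymm
  · rintro v ⟨b, hb, hc⟩
    apply hc.induct (P := fun v => v ∈ t)
    · rw [← ht]
      refine ⟨b, hb, Conn.refl ⟨(hin b (Or.inr ⟨hc.1.2, Or.inl hb⟩)).2 hc.1.1, hc.1.2⟩⟩
    · intro x y _ hr hy hx
      have : y ∈ ω := (hin y (Or.inr ⟨hy.2, Or.inr ⟨x, hx, hr⟩⟩)).2 hy.1
      rw [← ht] at hx ⊢
      exact Cl_closed hx hr ⟨this, hy.2⟩
  · intro v hv
    rw [← ht] at hv
    obtain ⟨b, hb, hc⟩ := hv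
    refine ⟨b, hb, (hc.in_Cl hb).mono ?_⟩
    rw [ht]
    intro x hx
    have hx' : x ∈ ω ∩ L := by rw [← ht] at hx; exact Cl_subset hx
    exact ⟨(hin x (Or.inl hx)).1 hx'.1, hx'.2⟩

lemma Cl_dep (L B t : Set V) : Dep (fun ω => Cl R (ω ∩ L) B = t) (clo R L B t) := by
  intro ω
  apply propext
  constructor
  · exact Cl_dep_aux (by simp [Set.inter_assoc])
  · exact Cl_dep_aux (by simp [Set.inter_assoc])

/-- Anything expressed through `ω ∩ L` depends only on `L`. -/
lemma dep_inter {α : Type*} (F : Set V → α) (L : Set V) : Dep (fun ω => F (ω ∩ L)) L := by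
  intro ω; simp [Set.inter_assoc]

end Perc

namespace Perc

/-! ### Planar topology -/

/-- `*`-adjacency (with loops). -/
def Star (a b : ℤ × ℤ) : Prop := |a.1 - b.1| ≤ 1 ∧ |a.2 - b.2| ≤ 1

lemma star_iff (a b : ℤ × ℤ) : Star a b ↔
    (a.1 - b.1 ≤ 1 ∧ b.1 - a.1 ≤ 1) ∧ (a.2 - b.2 ≤ 1 ∧ b.2 - a.2 ≤ 1) := by
  unfold Star; rw [abs_le, abs_le]
  constructor
  · rintro ⟨⟨h1, h2⟩, h3, h4⟩; refine ⟨⟨?_, ?_⟩, ?_, ?_⟩ <;> omega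
  · rintro ⟨⟨h1, h2⟩, h3, h4⟩; refine ⟨⟨?_, ?_⟩, ?_, ?_⟩ <;> omega

lemma adj_iff (a b : ℤ × ℤ) : Adjacent a b ↔
    (a.1 = b.1 ∧ (a.2 = b.2 + 1 ∨ b.2 = a.2 + 1)) ∨ (a.2 = b.2 ∧ (a.1 = b.1 + 1 ∨ b.1 = a.1 + 1)) := by
  unfold Adjacent
  rcases abs_cases (a.1 - b.1) with ⟨h1, h2⟩ | ⟨h1, h2⟩ <;>
  rcases abs_cases (a.2 - b.2) with ⟨h3, h4⟩ | ⟨h3, h4⟩ <;> rw [h1, h3] <;> constructor <;> intro h <;> omega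

lemma star_symm (a b : ℤ × ℤ) (h : Star a b) : Star b a := by
  rw [star_iff] at *; tauto

lemma adj_symm (a b : ℤ × ℤ) (h : Adjacent a b) : Adjacent b a := by
  rw [adj_iff] at *; omega

set_option maxHeartbeats 2000000 in
lemma arith1 {a1 a2 b1 b2 x y x' : ℤ}
    (hab : (a1 = b1 ∧ (a2 = b2 + 1 ∨ b2 = a2 + 1)) ∨ (a2 = b2 ∧ (a1 = b1 + 1 ∨ b1 = a1 + 1)))
    (s1 : x - x' ≤ 1) (s2 : x' - x ≤ 1)
    (n1 : ¬ (a1 = x ∧ a2 = y)) (n2 : ¬ (a1 = x' ∧ a2 = y)) (n3 : ¬ (b1 = x ∧ b2 = y)) (n4 : ¬ (b1 = x' ∧ b2 = y)) :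
    ((if a2 = y ∧ b2 = y + 1 ∧ x < a1 then 1 else 0) : ℤ) - (if b2 = y ∧ a2 = y + 1 ∧ x < a1 then 1 else 0)
    = (if a2 = y ∧ b2 = y + 1 ∧ x' < a1 then 1 else 0) - (if b2 = y ∧ a2 = y + 1 ∧ x' < a1 then 1 else 0) := by
  have e1 : (a2 = y ∧ b2 = y + 1 ∧ x < a1) ↔ (a2 = y ∧ b2 = y + 1 ∧ x' < a1) := by omega
  have e2 : (b2 = y ∧ a2 = y + 1 ∧ x < a1) ↔ (b2 = y ∧ a2 = y + 1 ∧ x' < a1) := by omega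
  simp only [e1, e2]

set_option maxHeartbeats 2000000 in
lemma arith2 {a1 a2 b1 b2 x y x' : ℤ}
    (hab : (a1 = b1 ∧ (a2 = b2 + 1 ∨ b2 = a2 + 1)) ∨ (a2 = b2 ∧ (a1 = b1 + 1 ∨ b1 = a1 + 1)))
    (s1 : x - x' ≤ 1) (s2 : x' - x ≤ 1)
    (n1 : ¬ (a1 = x ∧ a2 = y)) (n2 : ¬ (a1 = x' ∧ a2 = y + 1)) (n3 : ¬ (b1 = x ∧ b2 = y)) (n4 : ¬ (b1 = x' ∧ b2 = y + 1)) :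
    - (if a2 = y + 1 ∧ x' < a1 then 1 else 0) + ((if a2 = y + 1 ∧ b2 = y + 1 + 1 ∧ x' < a1 then 1 else 0) : ℤ) - (if b2 = y + 1 ∧ a2 = y + 1 + 1 ∧ x' < a1 then 1 else 0)
    = (if a2 = y ∧ b2 = y + 1 ∧ x < a1 then 1 else 0) - (if b2 = y ∧ a2 = y + 1 ∧ x < a1 then 1 else 0)
      - (if b2 = y + 1 ∧ x' < b1 then 1 else 0) := by
  rcases hab with ⟨rfl, rfl | rfl⟩ | ⟨rfl, rfl | rfl⟩
  · by_cases h1 : b2 = y + 1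
    · subst h1; have q1 : ¬ (y + 1 + 1 = y) := by omega
      by_cases h2 : x' < a1 <;> simp [h2, q1]
    · by_cases h3 : b2 = y
      · subst h3
        have : x < a1 ↔ x' < a1 := by omega
        have q1 : ∀ z : ℤ, ¬ (z = z + 1 + 1) := by omega
        by_cases h2 : x' < a1 <;> simp [h2, this, q1]
      · simp [h1, h3]
  · by_cases h1 : a2 = y + 1
    · subst h1; have q1 : ¬ (y + 1 + 1 = y) := by omega
      by_cases h2 : x' < a1 <;> simp [h2, q1]
    · by_cases h3 : a2 = y
      · subst h3
        have : x < a1 ↔ x' < a1 := by omega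
        have q1 : ∀ z : ℤ, ¬ (z = z + 1 + 1) := by omega
        by_cases h2 : x' < a1 <;> simp [h2, this, q1]
      · simp [h1, h3]
  · by_cases h1 : a2 = y + 1
    · have : x' < b1 + 1 ↔ x' < b1 := by omega
      simp [this, h1]
    · simp [h1]
  · by_cases h1 : a2 = y + 1
    · have : x' < a1 + 1 ↔ x' < a1 := by omega
      simp [this, h1]
    · simp [h1]

set_option maxHeartbeats 2000000 in
lemma arith3 {a1 a2 b1 b2 x y : ℤ}
    (hab : (a1 = b1 ∧ (a2 = b2 + 1 ∨ b2 = a2 + 1)) ∨ (a2 = b2 ∧ (a1 = b1 + 1 ∨ b1 = a1 + 1)))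
    (ha : y ≤ a2) (hb : y ≤ b2)
    (n1 : ¬ (a1 = x ∧ a2 = y)) (n3 : ¬ (b1 = x ∧ b2 = y)) :
    - (if a2 = y ∧ x < a1 then 1 else 0) + ((if a2 = y ∧ b2 = y + 1 ∧ x < a1 then 1 else 0) : ℤ) - (if b2 = y ∧ a2 = y + 1 ∧ x < a1 then 1 else 0)
    = - (if b2 = y ∧ x < b1 then 1 else 0) := by
  rcases hab with ⟨rfl, rfl | rfl⟩ | ⟨rfl, rfl | rfl⟩
  · by_cases h1 : b2 = y
    · subst h1; by_cases h2 : x < a1 <;> simp [h2]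
    · have : ¬ b2 + 1 = y := by omega
      simp [h1, this]
  · by_cases h1 : a2 = y
    · subst h1; by_cases h2 : x < a1 <;> simp [h2]
    · have : ¬ a2 + 1 = y := by omega
      simp [h1, this]
  · by_cases h1 : a2 = y
    · have : x < b1 + 1 ↔ x < b1 := by omega
      simp [this, h1]
    · simp [h1]
  · by_cases h1 : a2 = y
    · have : x < a1 + 1 ↔ x < a1 := by omega
      simp [this, h1]
    · simp [h1]

/-- An open left-right path and a closed `*`-path from bottom to top cannot coexist. -/
lemma not_both (lo hi : ℤ) (ω Q : Set (ℤ × ℤ))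
    (hQ : ∀ v ∈ Q, lo ≤ v.1 ∧ v.1 ≤ hi ∧ lo ≤ v.2 ∧ v.2 ≤ hi) {u v z t : ℤ × ℤ}
    (h1 : Conn Adjacent (ω ∩ Q) u v) (hu : u.1 = lo) (hv : v.1 = hi)
    (h2 : Conn Star (ωᶜ ∩ Q) z t) (hz : z.2 = lo) (ht : t.2 = hi) : False := by
  classical
  have key : ∃ w : ℤ × ℤ → ℤ,
      (∀ z ∈ ωᶜ ∩ Q, ∀ z' ∈ ωᶜ ∩ Q, Star z z' → z'.2 = z.2 → w z = w z') ∧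
      (∀ z ∈ ωᶜ ∩ Q, ∀ z' ∈ ωᶜ ∩ Q, Star z z' → z'.2 = z.2 + 1 →
        w z' = w z - (if v.2 = z'.2 ∧ z'.1 < v.1 then 1 else 0)) ∧
      (∀ z ∈ ωᶜ ∩ Q, z.2 = hi → w z = 0) ∧
      (∀ z ∈ ωᶜ ∩ Q, z.2 = lo → w z = - (if v.2 = lo ∧ z.1 < v.1 then 1 else 0)) := by
    clear hv
    apply h1.induct (P := fun v => ∃ w : ℤ × ℤ → ℤ,
      (∀ z ∈ ωᶜ ∩ Q, ∀ z' ∈ ωᶜ ∩ Q, Star z z' → z'.2 = z.2 → w z = w z') ∧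
      (∀ z ∈ ωᶜ ∩ Q, ∀ z' ∈ ωᶜ ∩ Q, Star z z' → z'.2 = z.2 + 1 →
        w z' = w z - (if v.2 = z'.2 ∧ z'.1 < v.1 then 1 else 0)) ∧
      (∀ z ∈ ωᶜ ∩ Q, z.2 = hi → w z = 0) ∧
      (∀ z ∈ ωᶜ ∩ Q, z.2 = lo → w z = - (if v.2 = lo ∧ z.1 < v.1 then 1 else 0)))
    · refine ⟨fun _ => 0, fun _ _ _ _ _ _ => rfl, ?_, fun _ _ _ => rfl, ?_⟩
      · intro z hz z' hz' _ _
        have := hQ z' hz'.2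
        rw [if_neg (by omega)]; rfl
      · intro z hz _
        have := hQ z hz.2
        rw [if_neg (by omega)]; rfl
    · rintro a b ha hr hb ⟨w, w1, w2, w3, w4⟩
      have hab := (adj_iff a b).1 hr
      have ha' := ha.mem_right
      have qa := hQ a ha'.2
      have qb := hQ b hb.2
      have ne : ∀ x ∈ ω ∩ Q, ∀ z ∈ ωᶜ ∩ Q, ¬ (x.1 = z.1 ∧ x.2 = z.2) := by
        rintro x hx z hz ⟨e1, e2⟩
        exact hz.1 (Prod.ext e1 e2 ▸ hx.1)
      refine ⟨fun z => w z + (if a.2 = z.2 ∧ b.2 = z.2 + 1 ∧ z.1 < a.1 then 1 else 0)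
        - (if b.2 = z.2 ∧ a.2 = z.2 + 1 ∧ z.1 < a.1 then 1 else 0), ?_, ?_, ?_, ?_⟩
      · intro z hz z' hz' hs he
        have hs' := (star_iff z z').1 hs
        have n1 := ne a ha' z hz
        have n2 := ne a ha' z' hz'
        have n3 := ne b hb z hz
        have n4 := ne b hb z' hz'
        have := w1 z hz z' hz' hs he
        rw [he] at n2 n4
        have ar := arith1 hab hs'.1.1 hs'.1.2 n1 n2 n3 n4
        simp only
        rw [he]
        omega
      · intro z hz z' hz' hs he
        have hs' := (star_iff z z').1 hs
        have n1 := ne a ha' z hz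
        have n2 := ne a ha' z' hz'
        have n3 := ne b hb z hz
        have n4 := ne b hb z' hz'
        have := w2 z hz z' hz' hs he
        rw [he] at n2 n4 this
        have ar := arith2 hab hs'.1.1 hs'.1.2 n1 n2 n3 n4
        simp only
        rw [he]
        omega
      · intro z hz he
        have := w3 z hz he
        simp only
        rw [this, if_neg (by omega), if_neg (by omega)]; rfl
      · intro z hz he
        have n1 := ne a ha' z hz
        have n3 := ne b hb z hz
        have := w4 z hz he
        rw [he] at n1 n3
        have ar := arith3 hab qa.2.2.1 qb.2.2.1 n1 n3
        simp only
        rw [he]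
        omega
  obtain ⟨w, w1, w2, w3, w4⟩ := key
  have hv' := h1.mem_right
  have qv := hQ v hv'.2
  have ne : ∀ z ∈ ωᶜ ∩ Q, ¬ (v.1 = z.1 ∧ v.2 = z.2) := by
    rintro z hz ⟨e1, e2⟩
    exact hz.1 (Prod.ext e1 e2 ▸ hv'.1)
  have fin : w t = - (if v.2 ≤ t.2 then 1 else 0) := by
    apply h2.induct (P := fun t => w t = - (if v.2 ≤ t.2 then 1 else 0))
    · rw [w4 z h2.1 hz]
      have := hQ z h2.1.2
      have := ne z h2.1
      split_ifs <;> omega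
    · intro a b ha hr hb ih
      have hs := (star_iff a b).1 hr
      have qa := hQ a ha.mem_right.2
      have qb := hQ b hb.2
      have na := ne a ha.mem_right
      have nb := ne b hb
      rcases lt_trichotomy a.2 b.2 with h | h | h
      · rw [w2 a ha.mem_right b hb hr (by omega), ih]
        split_ifs <;> omega
      · rw [← w1 a ha.mem_right b hb hr h.symm, ih, h]
      · have := w2 b hb a ha.mem_right (star_symm _ _ hr) (by omega)
        rw [ih] at this
        split_ifs at * <;> omega
  rw [w3 t h2.mem_right ht, if_pos (by omega)] at fin
  omega

set_option maxHeartbeats 2000000 in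
/-- If there is no open left-right crossing of the box, there is a closed `*`-crossing from top to bottom. -/
lemma dual_crossing (n : ℕ) (ω Q : Set (ℤ × ℤ)) (hQ : ∀ v, v ∈ Q ↔ 0 ≤ v.1 ∧ v.1 ≤ (n : ℤ) ∧ 0 ≤ v.2 ∧ v.2 ≤ (n : ℤ))
    (h : ∀ u v, Conn Adjacent (ω ∩ Q) u v → u.1 = 0 → v.1 ≠ n) :
    ∃ z t, Conn Star (ωᶜ ∩ Q) z t ∧ z.2 = n ∧ t.2 = 0 := by
  classical
  set A : Set (ℤ × ℤ) := {v | v.1 < 0} ∪ Cl Adjacent (ω ∩ Q) {v | v.1 = 0} with hA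
  set B : Set (ℤ × ℤ) := {v | v ∈ Q ∧ v ∉ A ∧ ∃ u ∈ A, Adjacent u v} with hB
  set D : Set (ℤ × ℤ) := Cl Star B {v | v.2 = n} with hD
  have hBω : B ⊆ ωᶜ ∩ Q := by
    rintro v ⟨h1, h2, u, hu, hr⟩
    refine ⟨fun hv => h2 ?_, h1⟩
    rcases hu with hu | hu
    · refine Or.inr ⟨v, ?_, Conn.refl ⟨hv, h1⟩⟩
      have := (adj_iff u v).1 hr
      have h1' := (hQ v).1 h1
      simp only [Set.mem_ofPred_eq] at hu ⊢
      omega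
    · exact Or.inr (Cl_closed hu hr ⟨hv, h1⟩)
  have hDB : D ⊆ B := Cl_subset
  by_contra hcon
  have hbot : ∀ v ∈ D, v.2 ≠ 0 := by
    rintro v ⟨b, hb, hc⟩ h0
    exact hcon ⟨b, v, hc.mono hBω, hb, h0⟩
  have hDA : ∀ v ∈ D, v ∉ A := fun v hv => (hDB hv).2.1
  have hAn : ∀ v ∈ A, v.1 ≠ n := by
    rintro v (hv | ⟨b, hb, hc⟩)
    · simp only [Set.mem_ofPred_eq] at hv; omega
    · exact h b v hc hb
  let c : ℤ × ℤ → ℤ × ℤ → ℤ := fun u v =>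
    (if v ∈ A ∧ u ∈ D then 1 else 0) - (if u ∈ A ∧ v ∈ D then 1 else 0)
  let χ : ℤ × ℤ → ℤ := fun v => if v ∈ A then 1 else 0
  -- closedness of the cochain on unit squares
  have edge0 : ∀ u v, u ∉ D → v ∉ D → c u v = 0 := by
    intro u v hu hv; simp [c, hu, hv]
  have edge1 : ∀ u v, (v ∈ A → u ∉ A → u ∈ D) → (u ∈ A → v ∉ A → v ∈ D) → c u v = χ v - χ u := by
    intro u v h1 h2
    have a1 := hDA u
    have a2 := hDA v
    simp only [c, χ]
    by_cases hu : u ∈ A <;> by_cases hv : v ∈ A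
    · have b1 : u ∉ D := fun h => a1 h hu
      have b2 : v ∉ D := fun h => a2 h hv
      simp [b1, b2, hu, hv]
    · have b1 : u ∉ D := fun h => a1 h hu
      have b2 : v ∈ D := h2 hu hv
      simp [b1, b2, hu, hv]
    · have b1 : u ∈ D := h1 hv hu
      have b2 : v ∉ D := fun h => a2 h hv
      simp [b1, b2, hu, hv]
    · simp [hu, hv]
  have memB : ∀ u v, Adjacent u v → v ∈ Q → u ∈ A → v ∉ A → v ∈ B := by
    intro u v hr hq hu hv; exact ⟨hq, hv, u, hu, hr⟩
  have sq : ∀ x y : ℤ, -1 ≤ x → x < n → 0 ≤ y → y < n →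
      c (x, y + 1) (x + 1, y + 1) - c (x, y) (x + 1, y) = c (x + 1, y) (x + 1, y + 1) - c (x, y) (x, y + 1) := by
    intro x y hx hxn hy hyn
    let K : Set (ℤ × ℤ) := {v | (v.1 = x ∨ v.1 = x + 1) ∧ (v.2 = y ∨ v.2 = y + 1)}
    have hKQ : ∀ v ∈ K, v ∉ A → v ∈ Q := by
      rintro v ⟨h1, h2⟩ hv
      have : ¬ v.1 < 0 := fun h => hv (Or.inl h)
      rw [hQ]; omega
    have e1 : ((x, y) : ℤ × ℤ) ∈ K := by simp [K]
    have e2 : ((x + 1, y) : ℤ × ℤ) ∈ K := by simp [K]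
    have e3 : ((x, y + 1) : ℤ × ℤ) ∈ K := by simp [K]
    have e4 : ((x + 1, y + 1) : ℤ × ℤ) ∈ K := by simp [K]
    by_cases hex : ∃ d ∈ K, d ∈ D
    · obtain ⟨d, hdK, hdD⟩ := hex
      have all : ∀ v ∈ K, v ∈ B → v ∈ D := by
        rintro v ⟨h1, h2⟩ hv
        obtain ⟨h3, h4⟩ := hdK
        exact Cl_closed hdD ((star_iff _ _).2 (by omega)) hv
      have ed : ∀ u ∈ K, ∀ v ∈ K, Adjacent u v → c u v = χ v - χ u := by
        intro u hu v hv hr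
        apply edge1
        · intro h1 h2; exact all u hu (memB v u (adj_symm _ _ hr) (hKQ u hu h2) h1 h2)
        · intro h1 h2; exact all v hv (memB u v hr (hKQ v hv h2) h1 h2)
      rw [ed _ e3 _ e4 (by rw [adj_iff]; simp), ed _ e1 _ e2 (by rw [adj_iff]; simp),
        ed _ e2 _ e4 (by rw [adj_iff]; simp), ed _ e1 _ e3 (by rw [adj_iff]; simp)]
      ring
    · push Not at hex
      rw [edge0 _ _ (hex _ e3) (hex _ e4), edge0 _ _ (hex _ e1) (hex _ e2),
        edge0 _ _ (hex _ e2) (hex _ e4), edge0 _ _ (hex _ e1) (hex _ e3)]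
      
  let r : ℤ → ℤ := fun y => ∑ i ∈ Finset.range (n + 1), c ((i : ℤ) - 1, y) ((i : ℤ) - 1 + 1, y)
  have rstep : ∀ y : ℤ, 0 ≤ y → y < n → r (y + 1) = r y := by
    intro y hy hyn
    have : r (y + 1) - r y = ∑ i ∈ Finset.range (n + 1),
        ((fun i : ℕ => c ((i : ℤ) - 1, y) ((i : ℤ) - 1, y + 1)) (i + 1) -
          (fun i : ℕ => c ((i : ℤ) - 1, y) ((i : ℤ) - 1, y + 1)) i) := by
      simp only [r]
      rw [← Finset.sum_sub_distrib]
      apply Finset.sum_congr rfl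
      intro i hi
      rw [Finset.mem_range] at hi
      rw [sq _ y (by omega) (by omega) hy hyn]
      push_cast
      rw [show (i : ℤ) + 1 - 1 = (i : ℤ) - 1 + 1 by ring]
    replace this := this.trans (Finset.sum_range_sub (fun i : ℕ => c ((i : ℤ) - 1, y) ((i : ℤ) - 1, y + 1)) (n + 1))
    have v1 : c (((n + 1 : ℕ) : ℤ) - 1, y) (((n + 1 : ℕ) : ℤ) - 1, y + 1) = 0 := by
      have a1 : ∀ y', ((((n + 1 : ℕ) : ℤ) - 1, y') : ℤ × ℤ) ∉ A := fun y' hy' => hAn _ hy' (by push_cast; ring)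
      simp only [c]
      rw [if_neg (fun hh => a1 _ hh.1), if_neg (fun hh => a1 _ hh.1)]; rfl
    have v2 : c (((0 : ℕ) : ℤ) - 1, y) (((0 : ℕ) : ℤ) - 1, y + 1) = 0 := by
      apply edge0 <;>
      · intro hh
        exact hDA _ hh (Or.inl (by simp))
    rw [v1, v2] at this
    omega
  have r0 : r 0 = 0 := by
    apply Finset.sum_eq_zero
    intro i _
    apply edge0 <;>
    · intro hh; exact hbot _ hh rfl
  have rall : ∀ k : ℕ, k ≤ n → r k = 0 := by
    intro k
    induction k with
    | zero => intro _; exact_mod_cast r0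
    | succ k ih =>
      intro hk
      push_cast
      rw [rstep k (by omega) (by omega), ih (by omega)]
  have rn : r n = -1 := by
    have : r n = ∑ i ∈ Finset.range (n + 1),
        ((fun i : ℕ => χ ((i : ℤ) - 1, n)) (i + 1) - (fun i : ℕ => χ ((i : ℤ) - 1, n)) i) := by
      apply Finset.sum_congr rfl
      intro i hi
      rw [Finset.mem_range] at hi
      rw [edge1]
      · push_cast
        rw [show (i : ℤ) + 1 - 1 = (i : ℤ) - 1 + 1 by ring]
      · intro h1 h2
        have hb := memB _ _ (by rw [adj_iff]; simp) ((hQ _).2 ?_) h1 h2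
        · exact ⟨_, by simp, Conn.refl hb⟩
        · have : ¬ ((i : ℤ) - 1 < 0) := fun h => h2 (Or.inl h)
          simp only; omega
      · intro h1 h2
        have hb := memB _ _ (by rw [adj_iff]; simp) ((hQ _).2 ?_) h1 h2
        · exact ⟨_, by simp, Conn.refl hb⟩
        · simp only; omega
    replace this := this.trans (Finset.sum_range_sub (fun i : ℕ => χ ((i : ℤ) - 1, n)) (n + 1))
    have a1 : χ (((n + 1 : ℕ) : ℤ) - 1, n) = 0 := if_neg (fun hh => hAn _ hh (by push_cast; ring))
    have a2 : χ (((0 : ℕ) : ℤ) - 1, n) = 1 := if_pos (Or.inl (by simp))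
    rw [a1, a2] at this
    omega
  have := rall n le_rfl
  omega

end Perc

namespace Perc

/-! ### The Menger theorem via the Hall marriage theorem -/

section Menger
variable {V : Type*} [DecidableEq V] [Inhabited V]

lemma menger (R : V → V → Prop) (G : Finset V) (A B : Set V) (k : ℕ)
    (h : ∀ K : Finset V, K.card < k → ∃ a b, a ∈ A ∧ b ∈ B ∧ Conn R ((G : Set V) \ K) a b) :
    ∃ P : Fin k → List V, (∀ i, P i ≠ [] ∧ (P i).IsChain R ∧ (∀ v ∈ P i, v ∈ G) ∧
      (∃ hd, (P i).head? = some hd ∧ hd ∈ A) ∧ (∃ l, (P i).getLast? = some l ∧ l ∈ B)) ∧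
      ∀ i j, i ≠ j → ∀ v ∈ P i, v ∉ P j := by
  classical
  let X := G ⊕ Fin k
  let rel : X → X → Prop := fun x y => match x, y with
    | .inr _, .inl a => (a : V) ∈ A
    | .inr _, .inr _ => False
    | .inl v, .inl w => v = w ∨ R v w
    | .inl v, .inr _ => (v : V) ∈ B
  let t : X → Finset X := fun x => Finset.univ.filter (rel x)
  have hall : ∀ U : Finset X, U.card ≤ (U.biUnion t).card := by
    intro U
    by_cases hJ : ∃ i : Fin k, Sum.inr i ∈ U
    · by_cases hWB : ∃ v : G, Sum.inl v ∈ U ∧ (v : V) ∈ B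
      · apply Finset.card_le_card
        intro x hx
        rw [Finset.mem_biUnion]
        rcases x with v | j
        · exact ⟨_, hx, by simp [t, rel]⟩
        · obtain ⟨v, hv, hb⟩ := hWB
          exact ⟨_, hv, by simp [t, rel, hb]⟩
      · obtain ⟨i, hi⟩ := hJ
        let W : Finset V := G.filter (fun v => ∃ hv : v ∈ G, Sum.inl ⟨v, hv⟩ ∈ U)
        let N : Finset V := G.filter (fun v => v ∈ A ∨ v ∈ W ∨ ∃ w ∈ W, R w v)
        have hWN : W ⊆ N := by
          intro v hv
          exact Finset.mem_filter.2 ⟨(Finset.mem_filter.1 hv).1, Or.inr (Or.inl hv)⟩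
        have hk : k ≤ (N \ W).card := by
          by_contra hlt
          push Not at hlt
          obtain ⟨a, b, ha, hb, hc⟩ := h _ hlt
          have hbW : b ∈ W := by
            apply hc.induct (P := fun b => b ∈ W)
            · by_contra haW
              have := hc.1
              refine this.2 ?_
              simp only [Finset.coe_sdiff, Set.mem_sdiff, Finset.mem_coe]
              exact ⟨Finset.mem_filter.2 ⟨this.1, Or.inl ha⟩, haW⟩
            · intro x y _ hr hy hx
              by_contra hyW
              refine hy.2 ?_
              simp only [Finset.coe_sdiff, Set.mem_sdiff, Finset.mem_coe]
              exact ⟨Finset.mem_filter.2 ⟨hy.1, Or.inr (Or.inr ⟨x, hx, hr⟩)⟩, hyW⟩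
          obtain ⟨hbG, hbG', hbU⟩ := Finset.mem_filter.1 hbW
          exact hWB ⟨_, hbU, hb⟩
        have c1 : U.card ≤ W.card + k := by
          have : U ⊆ (W.attach.image (fun v => (Sum.inl ⟨v.1, (Finset.mem_filter.1 v.2).1⟩ : X))) ∪
              (Finset.univ.image (fun j : Fin k => (Sum.inr j : X))) := by
            intro x hx
            rw [Finset.mem_union]
            rcases x with v | j
            · left
              rw [Finset.mem_image]
              exact ⟨⟨v.1, Finset.mem_filter.2 ⟨v.2, v.2, hx⟩⟩, Finset.mem_attach _ _, rfl⟩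
            · right; simp
          refine (Finset.card_le_card this).trans ((Finset.card_union_le _ _).trans ?_)
          apply add_le_add
          · exact Finset.card_image_le.trans (by simp)
          · exact Finset.card_image_le.trans (by simp)
        have c2 : N.card ≤ (U.biUnion t).card := by
          have hNG : ∀ v ∈ N, v ∈ G := fun v hv => (Finset.mem_filter.1 hv).1
          have : N.attach.image (fun v => (Sum.inl ⟨v.1, hNG _ v.2⟩ : X)) ⊆ U.biUnion t := by
            intro x hx
            obtain ⟨v, _, rfl⟩ := Finset.mem_image.1 hx
            rw [Finset.mem_biUnion]
            rcases (Finset.mem_filter.1 v.2).2 with h1 | h1 | ⟨w, h1, h2⟩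
            · exact ⟨_, hi, by simp [t, rel, h1]⟩
            · obtain ⟨_, hg, hu⟩ := Finset.mem_filter.1 h1
              exact ⟨_, hu, by simp [t, rel]⟩
            · obtain ⟨_, hg, hu⟩ := Finset.mem_filter.1 h1
              exact ⟨_, hu, by simp [t, rel, h2]⟩
          refine le_trans (le_of_eq ?_) (Finset.card_le_card this)
          rw [Finset.card_image_of_injective]
          · simp
          · intro x y hxy
            have h1 := congrArg Subtype.val (Sum.inl.inj hxy)
            exact Subtype.ext h1
        have c3 : (N \ W).card + W.card = N.card := Finset.card_sdiff_add_card_eq_card hWN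
        omega
    · apply Finset.card_le_card
      intro x hx
      rw [Finset.mem_biUnion]
      rcases x with v | j
      · exact ⟨_, hx, by simp [t, rel]⟩
      · exact absurd ⟨j, hx⟩ hJ
  obtain ⟨f, finj, hf⟩ := (Finset.all_card_le_biUnion_card_iff_exists_injective t).1 hall
  have hrel : ∀ x, rel x (f x) := fun x => (Finset.mem_filter.1 (hf x)).2
  have hex : ∀ i : Fin k, ∃ m : ℕ, 1 ≤ m ∧ ∃ j : Fin k, f^[m] (Sum.inr i) = Sum.inr j := by
    intro i
    obtain ⟨m, hm, hp⟩ := finj.mem_periodicPts (Sum.inr i)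
    exact ⟨m, hm, i, hp⟩
  let m : Fin k → ℕ := fun i => Nat.find (hex i)
  have hm : ∀ i, 1 ≤ m i ∧ ∃ j : Fin k, f^[m i] (Sum.inr i) = Sum.inr j := fun i => Nat.find_spec (hex i)
  have hmin : ∀ i l, 1 ≤ l → l < m i → ∃ v, f^[l] (Sum.inr i) = Sum.inl v := by
    intro i l h1 h2
    have := Nat.find_min (hex i) h2
    rcases hx : f^[l] (Sum.inr i) with v | j
    · exact ⟨v, rfl⟩
    · exact absurd ⟨h1, j, hx⟩ this
  have hm2 : ∀ i, 2 ≤ m i := by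
    intro i
    rcases Nat.lt_or_ge (m i) 2 with h1 | h1
    · obtain ⟨h2, j, h3⟩ := hm i
      have : m i = 1 := by omega
      rw [this] at h3
      have h4 := hrel (Sum.inr i)
      simp only [Function.iterate_one] at h3
      rw [h3] at h4
      exact h4.elim
    · exact h1
  let un : X → V := fun x => Sum.elim (fun v : G => (v : V)) (fun _ => default) x
  let P : Fin k → List V := fun i => (List.range (m i - 1)).map (fun l => un (f^[l + 1] (Sum.inr i)))
  have hlen : ∀ i, (P i).length = m i - 1 := by intro i; simp [P]
  have hsucc : ∀ i l, f^[l + 1] (Sum.inr i : X) = f (f^[l] (Sum.inr i)) := fun i l => Function.iterate_succ_apply' _ _ _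
  refine ⟨P, ?_, ?_⟩
  · intro i
    have h2 := hm2 i
    refine ⟨?_, ?_, ?_, ?_, ?_⟩
    · intro h0
      have := hlen i
      rw [h0] at this
      simp at this
      omega
    · rw [List.isChain_iff_getElem]
      intro l hl
      rw [hlen] at hl
      obtain ⟨v, hv⟩ := hmin i (l + 1) (by omega) (by omega)
      obtain ⟨w, hw⟩ := hmin i (l + 1 + 1) (by omega) (by omega)
      simp only [P, List.getElem_map, List.getElem_range, hv, hw]
      have h3 := hsucc i (l + 1)
      rw [hw, hv] at h3
      have h4 := hrel (Sum.inl v)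
      rw [← h3] at h4
      rcases h4 with h4 | h4
      · exfalso
        rw [← h4, ← hv] at h3
        have : f^[l + 1] (f (Sum.inr i)) = f^[l + 1] (Sum.inr i) := by
          rw [← Function.iterate_succ_apply, Function.iterate_succ_apply', ← h3]
        have h5 := finj.iterate _ this
        have h6 := hrel (Sum.inr i)
        rw [h5] at h6
        exact h6.elim
      · exact h4
    · intro v hv
      obtain ⟨l, hl, rfl⟩ := List.mem_map.1 hv
      rw [List.mem_range] at hl
      obtain ⟨v, hv⟩ := hmin i (l + 1) (by omega) (by omega)
      simp [hv, un]
    · obtain ⟨v, hv⟩ := hmin i 1 le_rfl (by omega)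
      refine ⟨v, ?_, ?_⟩
      · simp only [P, List.head?_map]
        rw [List.head?_range, if_neg (by omega)]
        simp only [Option.map_some, zero_add, hv, un, Sum.elim_inl]
      · have h4 := hrel (Sum.inr i)
        simp only [Function.iterate_one] at hv
        rw [hv] at h4
        exact h4
    · obtain ⟨v, hv⟩ := hmin i (m i - 1) (by omega) (by omega)
      refine ⟨v, ?_, ?_⟩
      · simp only [P, List.getLast?_map]
        rw [List.getLast?_range, if_neg (by omega)]
        simp only [Option.map_some]
        rw [show m i - 1 - 1 + 1 = m i - 1 by omega, hv]
        rfl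
      · obtain ⟨_, j, h3⟩ := hm i
        have h4 := hrel (Sum.inl v)
        have h5 := hsucc i (m i - 1)
        rw [show m i - 1 + 1 = m i by omega, h3, hv] at h5
        rw [← h5] at h4
        exact h4
  · have main : ∀ i j l l', 1 ≤ l → l ≤ l' → l' < m j → f^[l] (Sum.inr i : X) = f^[l'] (Sum.inr j) → i = j := by
      intro i j l l' h1 h2 h3 h4
      have : f^[l] (Sum.inr i : X) = f^[l] (f^[l' - l] (Sum.inr j)) := by
        rw [h4, ← Function.iterate_add_apply]; congr 1; congr 1; omega
      have h5 := finj.iterate _ this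
      rcases Nat.eq_zero_or_pos (l' - l) with h6 | h6
      · rw [h6] at h5
        exact Sum.inr.inj h5
      · obtain ⟨v, hv⟩ := hmin j (l' - l) h6 (by omega)
        rw [hv] at h5
        cases h5
    intro i j hij v hv hv'
    obtain ⟨l, hl, hlv⟩ := List.mem_map.1 hv
    obtain ⟨l', hl', hlv'⟩ := List.mem_map.1 hv'
    rw [List.mem_range] at hl hl'
    obtain ⟨x, hx⟩ := hmin i (l + 1) (by omega) (by omega)
    obtain ⟨y, hy⟩ := hmin j (l' + 1) (by omega) (by omega)
    simp only [hx, un, Sum.elim_inl] at hlv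
    simp only [hy, un, Sum.elim_inl] at hlv'
    have hxy : x = y := Subtype.ext (hlv.trans hlv'.symm)
    have e : f^[l + 1] (Sum.inr i : X) = f^[l' + 1] (Sum.inr j) := by rw [hx, hy, hxy]
    rcases Nat.le_total l l' with h1 | h1
    · exact hij (main i j _ _ (by omega) (by omega) (by omega) e)
    · exact hij (main j i _ _ (by omega) (by omega) (by omega) e.symm).symm

end Menger
end Perc

namespace Perc

/-! ### Boxes -/

lemma E_explore {V : Type*} [DecidableEq V] (q : ℝ) {Λ S : Finset V} (hS : S ⊆ Λ) (R : V → V → Prop) (B : Set V)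
    (g : Set V → Set V → ℝ) (hg : ∀ t : Set V, t ⊆ ↑S → Dep (g t) (↑Λ \ clo R ↑S B t)) :
    E q Λ (fun ω => g (Cl R (ω ∩ ↑S) B) ω) =
      ∑ t ∈ S.powerset, E q Λ (fun ω => ind (Cl R (ω ∩ ↑S) B = ↑t)) * E q Λ (g ↑t) := by
  classical
  have h1 : E q Λ (fun ω => g (Cl R (ω ∩ ↑S) B) ω) =
      E q Λ (fun ω => ∑ t ∈ S.powerset, ind (Cl R (ω ∩ ↑S) B = ↑t) * g ↑t ω) := by
    apply E_congr
    intro ω _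
    have hsub : Cl R (ω ∩ ↑S) B ⊆ ↑S := Cl_subset.trans Set.inter_subset_right
    have hfin : (Cl R (ω ∩ ↑S) B).Finite := S.finite_toSet.subset hsub
    rw [Finset.sum_eq_single hfin.toFinset]
    · rw [ind_true (by simp), one_mul]; simp
    · intro t _ ht
      rw [ind_false, zero_mul]
      intro he
      apply ht
      ext v; rw [Set.Finite.mem_toFinset, he]; simp
    · intro hn
      exfalso; apply hn
      rw [Finset.mem_powerset]
      intro v hv
      rw [Set.Finite.mem_toFinset] at hv
      exact hsub hv
  rw [h1, E_sum]
  apply Finset.sum_congr rfl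
  intro t ht
  rw [Finset.mem_powerset] at ht
  have hcl : clo R (↑S) B (↑t : Set V) ⊆ ↑Λ := by
    rintro v (hv | ⟨hv, _⟩)
    · exact hS (ht hv)
    · exact hS hv
  refine E_mul q (S1 := Λ.filter (· ∈ clo R ↑S B ↑t)) (S2 := Λ.filter (· ∉ clo R ↑S B ↑t))
    (Finset.filter_subset _ _) (Finset.filter_subset _ _) (Finset.disjoint_filter_filter_not _ _ _) _ _ ?_ ?_
  · apply Dep.ind
    apply (Cl_dep (R := R) (↑S) B ↑t).mono
    intro v hv
    simp only [Finset.coe_filter]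
    exact ⟨hcl hv, hv⟩
  · apply (hg t (by exact_mod_cast ht)).mono
    intro v hv
    simp only [Finset.coe_filter]
    exact hv

lemma E_explore_le {V : Type*} [DecidableEq V] {q : ℝ} (h0 : 0 ≤ q) (h1 : q ≤ 1)
    {Λ S : Finset V} (hS : S ⊆ Λ) (R : V → V → Prop) (B : Set V)
    (g g' : Set V → Set V → ℝ) (hg : ∀ t : Set V, t ⊆ ↑S → Dep (g t) (↑Λ \ clo R ↑S B t))
    (hg' : ∀ t : Set V, t ⊆ ↑S → Dep (g' t) (↑Λ \ clo R ↑S B t))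
    (hle : ∀ t : Set V, t ⊆ ↑S → E q Λ (g t) ≤ E q Λ (g' t)) :
    E q Λ (fun ω => g (Cl R (ω ∩ ↑S) B) ω) ≤ E q Λ (fun ω => g' (Cl R (ω ∩ ↑S) B) ω) := by
  rw [E_explore q hS R B g hg, E_explore q hS R B g' hg']
  apply Finset.sum_le_sum
  intro t ht
  rw [Finset.mem_powerset] at ht
  exact mul_le_mul_of_nonneg_left (hle t (by exact_mod_cast ht)) (E_nonneg h0 h1 _ (fun _ => ind_nonneg _))

/-- The box `[-n,n]²`. -/
noncomputable def Lam (n : ℕ) : Finset (ℤ × ℤ) := Finset.Icc (-(n : ℤ), -(n : ℤ)) ((n : ℤ), (n : ℤ))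

lemma mem_Lam {n : ℕ} {v : ℤ × ℤ} : v ∈ Lam n ↔ (-(n : ℤ) ≤ v.1 ∧ v.1 ≤ n) ∧ (-(n : ℤ) ≤ v.2 ∧ v.2 ≤ n) := by
  simp only [Lam, Finset.mem_Icc, Prod.le_def]; tauto

/-- The inner boundary of the box. -/
def bd (n : ℕ) : Set (ℤ × ℤ) := {v | v ∈ Lam n ∧ (v.1 = n ∨ v.1 = -(n : ℤ) ∨ v.2 = n ∨ v.2 = -(n : ℤ))}

lemma zero_mem_Lam (n : ℕ) : (0 : ℤ × ℤ) ∈ Lam n := by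
  rw [mem_Lam]; simp

lemma Lam_mono {m n : ℕ} (h : m ≤ n) : Lam m ⊆ Lam n := by
  intro v; rw [mem_Lam, mem_Lam]; omega

/-- The neighbours of a site. -/
noncomputable def NB (x : ℤ × ℤ) : Finset (ℤ × ℤ) := Finset.Icc (x - (1, 1)) (x + (1, 1))

lemma mem_NB {x y : ℤ × ℤ} : y ∈ NB x ↔ Star x y := by
  rw [star_iff]; simp only [NB, Finset.mem_Icc, Prod.le_def, Prod.fst_sub, Prod.fst_add, Prod.snd_sub, Prod.snd_add]
  omega

lemma card_NB (x : ℤ × ℤ) : (NB x).card = 9 := by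
  rw [NB, Finset.Icc_prod_def, Finset.card_product]
  simp only [Int.card_Icc, Prod.fst_sub, Prod.fst_add, Prod.snd_sub, Prod.snd_add]
  rw [show x.1 + 1 + 1 - (x.1 - 1) = 3 by ring, show x.2 + 1 + 1 - (x.2 - 1) = 3 by ring]
  rfl

/-- The event that `y` is connected to the boundary of the box of radius `n` about it. -/
def Arm (R : ℤ × ℤ → ℤ × ℤ → Prop) (n : ℕ) (y : ℤ × ℤ) (ω : Set (ℤ × ℤ)) : Prop :=
  ∃ v, v - y ∈ bd n ∧ Conn R (ω ∩ {w | w - y ∈ Lam n}) y v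

noncomputable def theta (R : ℤ × ℤ → ℤ × ℤ → Prop) (n : ℕ) (q : ℝ) : ℝ :=
  E q (Lam n) (fun ω => ind (Arm R n 0 ω))

lemma arm_of_conn {R : ℤ × ℤ → ℤ × ℤ → Prop} (hR : ∀ a b, R a b → Star a b) {n : ℕ} {y v : ℤ × ℤ} {ω : Set (ℤ × ℤ)}
    (h : Conn R ω y v) (hv : v - y ∉ Lam n ∨ v - y ∈ bd n) : Arm R n y ω := by
  rcases h.first_exit {w | w - y ∈ Lam n} (by simp [zero_mem_Lam]) with h1 | ⟨a, b, h1, h2, h3, h4⟩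
  · rcases hv with hv | hv
    · exact absurd h1.mem_right.2 hv
    · exact ⟨v, hv, h1⟩
  · refine ⟨a, ⟨h1.mem_right.2, ?_⟩, h1⟩
    have := (star_iff _ _).1 (hR _ _ h2)
    have h5 := h1.mem_right.2
    simp only [Set.mem_ofPred_eq, mem_Lam, Prod.fst_sub, Prod.snd_sub] at h4 h5 ⊢
    omega

lemma Arm.mono {R : ℤ × ℤ → ℤ × ℤ → Prop} {n : ℕ} {y : ℤ × ℤ} {ω ω' : Set (ℤ × ℤ)} (h : Arm R n y ω) (hω : ω ⊆ ω') :
    Arm R n y ω' := by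
  obtain ⟨v, h1, h2⟩ := h
  exact ⟨v, h1, h2.mono (Set.inter_subset_inter_left _ hω)⟩

lemma arm_dep (R : ℤ × ℤ → ℤ × ℤ → Prop) (n : ℕ) (y : ℤ × ℤ) : Dep (Arm R n y) {w | w - y ∈ Lam n} := by
  intro ω
  simp only [Arm, Set.inter_assoc, Set.inter_self]

/-- Translation as an equivalence. -/
def tr (x : ℤ × ℤ) : (ℤ × ℤ) ≃ (ℤ × ℤ) := Equiv.addRight x

@[simp] lemma tr_apply (x v : ℤ × ℤ) : tr x v = v + x := rfl

lemma mem_tr_image (x : ℤ × ℤ) (ω : Set (ℤ × ℤ)) (v : ℤ × ℤ) : v ∈ tr x '' ω ↔ v - x ∈ ω := by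
  constructor
  · rintro ⟨w, hw, rfl⟩; simpa using hw
  · intro h; exact ⟨v - x, h, by simp⟩

/-- The standing assumptions on an adjacency relation. -/
structure Nice (R : ℤ × ℤ → ℤ × ℤ → Prop) : Prop where
  symm : ∀ a b, R a b → R b a
  star : ∀ a b, R a b → Star a b
  adj : ∀ a b, Adjacent a b → R a b
  trans : ∀ x a b, R a b → R (a + x) (b + x)
  rot : ∀ a b : ℤ × ℤ, R a b → R (-a.2, a.1) (-b.2, b.1)

lemma nice_star : Nice Star where
  symm := star_symm
  star := fun _ _ h => h
  adj := fun a b h => by rw [adj_iff] at h; rw [star_iff]; omega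
  trans := fun x a b h => by rw [star_iff] at *; simp only [Prod.fst_add, Prod.snd_add]; omega
  rot := fun a b h => by rw [star_iff] at *; simp only; omega

lemma nice_adj : Nice Adjacent where
  symm := adj_symm
  star := fun a b h => by rw [adj_iff] at h; rw [star_iff]; omega
  adj := fun _ _ h => h
  trans := fun x a b h => by rw [adj_iff] at *; simp only [Prod.fst_add, Prod.snd_add]; omega
  rot := fun a b h => by rw [adj_iff] at *; simp only; omega

/-- Translated boxes. -/
noncomputable def LamT (n : ℕ) (x : ℤ × ℤ) : Finset (ℤ × ℤ) := (Lam n).map (tr x).toEmbedding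

lemma mem_LamT {n : ℕ} {x v : ℤ × ℤ} : v ∈ LamT n x ↔ v - x ∈ Lam n := by
  rw [LamT, Finset.mem_map_equiv]; rfl

lemma conn_tr {R : ℤ × ℤ → ℤ × ℤ → Prop} (hR : Nice R) (x : ℤ × ℤ) (G : Set (ℤ × ℤ)) (u v : ℤ × ℤ) :
    Conn R (tr x '' G) (u + x) (v + x) ↔ Conn R G u v := by
  constructor
  · intro h
    have := h.map (tr (-x)) (fun a b hab => hR.trans _ _ _ hab)
    rw [← Set.image_comp] at this
    have e : (tr (-x)) ∘ (tr x) = id := by ext v <;> simp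
    rw [e] at this
    simpa using this
  · intro h; exact h.map (tr x) (fun a b hab => hR.trans _ _ _ hab)

lemma tr_inter (x : ℤ × ℤ) (n : ℕ) (ω : Set (ℤ × ℤ)) :
    tr x '' ω ∩ {w | w - x ∈ Lam n} = tr x '' (ω ∩ ↑(Lam n)) := by
  ext v
  rw [Set.mem_inter_iff, mem_tr_image, mem_tr_image]; rfl

lemma arm_tr {R : ℤ × ℤ → ℤ × ℤ → Prop} (hR : Nice R) (n : ℕ) (x : ℤ × ℤ) (ω : Set (ℤ × ℤ)) :
    Arm R n x (tr x '' ω) ↔ Arm R n 0 ω := by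
  unfold Arm
  rw [tr_inter]
  simp only [sub_zero]
  constructor
  · rintro ⟨v, h1, h2⟩
    refine ⟨v - x, h1, ?_⟩
    have := (conn_tr hR x (ω ∩ ↑(Lam n)) 0 (v - x)).1 (by simpa using h2)
    exact this
  · rintro ⟨v, h1, h2⟩
    refine ⟨v + x, by simpa using h1, ?_⟩
    have := (conn_tr hR x (ω ∩ ↑(Lam n)) 0 v).2 h2
    simpa using this

lemma E_arm {R : ℤ × ℤ → ℤ × ℤ → Prop} (hR : Nice R) (q : ℝ) (n : ℕ) (x : ℤ × ℤ) {Λ : Finset (ℤ × ℤ)}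
    (h : LamT n x ⊆ Λ) : E q Λ (fun ω => ind (Arm R n x ω)) = theta R n q := by
  rw [E_dep q h]
  · rw [LamT, E_map, theta]
    apply E_congr
    intro ω _
    rw [ind_congr (arm_tr hR n x ω)]
  · apply Dep.ind
    apply (arm_dep R n x).mono
    intro v hv
    exact mem_LamT.2 hv

lemma theta_le_one (R : ℤ × ℤ → ℤ × ℤ → Prop) (n : ℕ) {q : ℝ} (h0 : 0 ≤ q) (h1 : q ≤ 1) : theta R n q ≤ 1 :=
  E_ind_le_one h0 h1 _ _

lemma theta_nonneg (R : ℤ × ℤ → ℤ × ℤ → Prop) (n : ℕ) {q : ℝ} (h0 : 0 ≤ q) (h1 : q ≤ 1) : 0 ≤ theta R n q :=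
  E_nonneg h0 h1 _ (fun _ => ind_nonneg _)

/-! ### The Duminil-Copin–Tassion argument -/

noncomputable def phi (q : ℝ) (S : Finset (ℤ × ℤ)) : ℝ :=
  ∑ x ∈ S, ∑ _y ∈ NB x \ S, E q S (fun ω => ind (Conn Star (ω ∩ ↑S) 0 x))

lemma phi_mono {q q' : ℝ} (h0 : 0 ≤ q) (h : q ≤ q') (h1 : q' ≤ 1) (S : Finset (ℤ × ℤ)) : phi q S ≤ phi q' S := by
  apply Finset.sum_le_sum; intro x _
  apply Finset.sum_le_sum; intro y _
  apply E_mono_p h0 h h1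
  intro ω ω' hω
  exact ind_mono (fun hc => hc.mono (Set.inter_subset_inter_left _ hω))

lemma decay {q : ℝ} (h0 : 0 ≤ q) (h1 : q ≤ 1) (S : Finset (ℤ × ℤ)) (L N : ℕ) (hS : S ⊆ Lam L) (h0S : 0 ∈ S) :
    theta Star (N + L + 1) q ≤ phi q S * theta Star N q := by
  classical
  set M := N + L + 1 with hM
  have hSM : S ⊆ Lam M := hS.trans (Lam_mono (by omega))
  set C : Set (ℤ × ℤ) → Set (ℤ × ℤ) := fun ω => Cl Star (ω ∩ ↑S) {0} with hC
  let g : ℤ × ℤ → ℤ × ℤ → Set (ℤ × ℤ) → Set (ℤ × ℤ) → ℝ := fun x y t ω =>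
    ind (x ∈ t) * ind (Arm Star N y (ω ∩ (↑(Lam M) \ clo Star ↑S {0} t)))
  have step1 : theta Star M q ≤ E q (Lam M) (fun ω => ∑ x ∈ S, ∑ y ∈ NB x \ S, g x y (C ω) ω) := by
    apply E_mono h0 h1
    intro ω _
    by_cases hA : Arm Star M 0 ω
    swap
    · rw [ind_false hA]
      exact Finset.sum_nonneg fun x _ => Finset.sum_nonneg fun y _ => mul_nonneg (ind_nonneg _) (ind_nonneg _)
    obtain ⟨v, hv, hc⟩ := hA
    simp only [sub_zero] at hv hc
    have hc0 := hc.1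
    have h0C : (0 : ℤ × ℤ) ∈ C ω := ⟨0, rfl, Conn.refl ⟨hc0.1, h0S⟩⟩
    have hvS : v ∉ S := by
      intro hvS
      have h2 := mem_Lam.1 (hS hvS)
      obtain ⟨_, h3⟩ := hv
      omega
    have hvC : v ∉ C ω := fun h => hvS (Cl_subset h).2
    obtain ⟨x, y, hx, _, hr, hyv⟩ := hc.last_exit (C ω) h0C hvC
    have hy := hyv.1
    have hcl : ∀ w, w ∈ (ω ∩ {w | w ∈ Lam M}) \ C ω → w ∉ clo Star (↑S) {0} (C ω) := by
      rintro w hw (h3 | ⟨h3, h4⟩)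
      · exact hw.2 h3
      · rcases h4 with h4 | ⟨z, h4, h5⟩
        · rw [Set.mem_singleton_iff] at h4
          subst h4; exact hw.2 h0C
        · exact hw.2 (Cl_closed h4 h5 ⟨hw.1.1, h3⟩)
    have hyS : y ∉ S := by
      intro hyS
      exact hy.2 (Cl_closed hx hr ⟨hy.1.1, hyS⟩)
    have hxS : x ∈ S := (Cl_subset hx).2
    have harm : Arm Star N y (ω ∩ (↑(Lam M) \ clo Star ↑S {0} (C ω))) := by
      apply arm_of_conn (v := v) (fun _ _ h => h)
      · apply hyv.mono
        intro w hw
        exact ⟨hw.1.1, hw.1.2, hcl w hw⟩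
      · have h2 := mem_Lam.1 (hS hxS)
        have h3 := (star_iff _ _).1 hr
        obtain ⟨h4, h5⟩ := hv
        rw [mem_Lam] at h4
        by_cases h6 : v - y ∈ Lam N
        · right
          refine ⟨h6, ?_⟩
          rw [mem_Lam] at h6
          simp only [Prod.fst_sub, Prod.snd_sub] at h6 ⊢
          omega
        · left; exact h6
    have hg1 : g x y (C ω) ω = 1 := by
      simp only [g]; rw [ind_true hx, ind_true harm, one_mul]
    calc ind (Arm Star M 0 ω) ≤ g x y (C ω) ω := by rw [hg1]; exact ind_le_one _
      _ ≤ ∑ y ∈ NB x \ S, g x y (C ω) ω := by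
        apply Finset.single_le_sum (f := fun y => g x y (C ω) ω)
          (fun y _ => mul_nonneg (ind_nonneg _) (ind_nonneg _))
        exact Finset.mem_sdiff.2 ⟨mem_NB.2 hr, hyS⟩
      _ ≤ _ := by
        apply Finset.single_le_sum (f := fun x => ∑ y ∈ NB x \ S, g x y (C ω) ω)
          (fun x _ => Finset.sum_nonneg fun y _ => mul_nonneg (ind_nonneg _) (ind_nonneg _)) hxS
  refine step1.trans ?_
  rw [E_sum, phi, Finset.sum_mul]
  apply Finset.sum_le_sum
  intro x hx
  rw [E_sum, Finset.sum_mul]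
  apply Finset.sum_le_sum
  intro y hy
  have hyL : LamT N y ⊆ Lam M := by
    intro w hw
    have h2 := mem_Lam.1 (hS hx)
    have h3 := (star_iff _ _).1 (mem_NB.1 (Finset.mem_sdiff.1 hy).1)
    rw [mem_LamT, mem_Lam] at hw
    rw [mem_Lam]
    simp only [Prod.fst_sub, Prod.snd_sub] at hw
    omega
  have := E_explore_le h0 h1 hSM Star {0} (g x y) (fun t _ => theta Star N q * ind (x ∈ t)) ?_ ?_ ?_
  · refine this.trans (le_of_eq ?_)
    rw [E_mul_left, mul_comm]
    congr 1
    rw [← E_dep q hSM]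
    · apply E_congr
      intro ω _
      apply ind_congr
      simp [Cl]
    · apply Dep.ind
      exact dep_inter (fun ω => Conn Star ω 0 x) _
  · intro t _ ω
    simp only [g]
    rw [Set.inter_assoc, Set.inter_self]
  · intro t _ ω
    rfl
  · intro t _
    simp only [g]
    rw [E_mul_left, E_const, mul_comm]
    apply mul_le_mul_of_nonneg_right _ (ind_nonneg _)
    rw [← E_arm nice_star q N y hyL]
    apply E_mono h0 h1
    intro ω _
    exact ind_mono (fun h => h.mono Set.inter_subset_left)

lemma decay_pow {q : ℝ} (h0 : 0 ≤ q) (h1 : q ≤ 1) (S : Finset (ℤ × ℤ)) (L : ℕ) (hS : S ⊆ Lam L) (h0S : 0 ∈ S) (k : ℕ) :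
    theta Star (k * (L + 1)) q ≤ phi q S ^ k := by
  have hphi : 0 ≤ phi q S := Finset.sum_nonneg fun x _ => Finset.sum_nonneg fun y _ =>
    E_nonneg h0 h1 _ (fun _ => ind_nonneg _)
  induction k with
  | zero => simpa using theta_le_one Star _ h0 h1
  | succ k ih =>
    have := decay h0 h1 S L (k * (L + 1)) hS h0S
    rw [show (k + 1) * (L + 1) = k * (L + 1) + L + 1 by ring, pow_succ']
    exact this.trans (mul_le_mul_of_nonneg_left ih hphi)

end Perc

namespace Perc

lemma theta_deriv {q : ℝ} (h0 : 0 ≤ q) (h1 : q ≤ 1) (hphi : ∀ S : Finset (ℤ × ℤ), 0 ∈ S → 1 ≤ phi q S) (n : ℕ) :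
    (1 / 9) * (1 - theta Star n q) ≤
      ∑ v ∈ Lam n, E q (Lam n) (fun ω => ind (Arm Star n 0 (insert v ω)) - ind (Arm Star n 0 (ω \ {v}))) := by
  classical
  set T : Set (ℤ × ℤ) → Set (ℤ × ℤ) := fun ω => Cl Star (ω ∩ ↑(Lam n)) (bd n) with hT
  let cl : Set (ℤ × ℤ) → Set (ℤ × ℤ) := fun t => clo Star (↑(Lam n)) (bd n) t
  have armT : ∀ ω, Arm Star n 0 ω ↔ 0 ∈ T ω := by
    intro ω
    constructor
    · rintro ⟨v, h2, h3⟩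
      simp only [sub_zero] at h2 h3
      exact ⟨v, h2, h3.symm star_symm⟩
    · rintro ⟨v, h2, h3⟩
      refine ⟨v, by simpa using h2, ?_⟩
      simp only [sub_zero]
      exact h3.symm star_symm
  -- the lower bound for the pivotal sum
  let g : Set (ℤ × ℤ) → Set (ℤ × ℤ) → ℝ := fun t ω => ind (0 ∉ t) * (ind (0 ∈ cl t) + ind (0 ∉ cl t) *
    ∑ v ∈ (Lam n).filter (· ∈ cl t), ind (∃ x, x ∉ cl t ∧ Star x v ∧ Conn Star (ω ∩ (↑(Lam n) \ cl t)) 0 x))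
  rw [← E_sum]
  have step : E q (Lam n) (fun ω => g (T ω) ω) ≤
      E q (Lam n) (fun ω => ∑ v ∈ Lam n, (ind (Arm Star n 0 (insert v ω)) - ind (Arm Star n 0 (ω \ {v})))) := by
    apply E_mono h0 h1
    intro ω _
    have hnn : ∀ v, 0 ≤ ind (Arm Star n 0 (insert v ω)) - ind (Arm Star n 0 (ω \ {v})) := by
      intro v
      have := ind_mono (Q := Arm Star n 0 (ω \ {v})) (Q' := Arm Star n 0 (insert v ω))
        (fun h => h.mono (Set.sdiff_subset.trans (Set.subset_insert _ _)))
      linarith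
    simp only [g]
    by_cases h0T : 0 ∈ T ω
    · rw [ind_false (not_not.2 h0T), zero_mul]
      exact Finset.sum_nonneg fun v _ => hnn v
    rw [ind_true h0T, one_mul]
    have hno : ∀ v, ind (Arm Star n 0 (ω \ {v})) = 0 := by
      intro v
      apply ind_false
      intro h
      exact h0T ((armT ω).1 (h.mono Set.sdiff_subset))
    -- opening a boundary site of T connects it to the boundary
    have conn1 : ∀ v ∈ cl (T ω), v ∈ Lam n → ∃ b ∈ bd n, Conn Star (insert v ω ∩ ↑(Lam n)) b v := by
      intro v hv hvL
      have hvin : v ∈ insert v ω ∩ ↑(Lam n) := ⟨Set.mem_insert _ _, hvL⟩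
      rcases hv with ⟨b, hb, hc⟩ | ⟨_, hb | ⟨x, ⟨b, hb, hc⟩, hr⟩⟩
      · exact ⟨b, hb, hc.mono (Set.inter_subset_inter_left _ (Set.subset_insert _ _))⟩
      · exact ⟨v, hb, Conn.refl hvin⟩
      · exact ⟨b, hb, (hc.mono (Set.inter_subset_inter_left _ (Set.subset_insert _ _))).tail hr hvin⟩
    by_cases h0c : 0 ∈ cl (T ω)
    · rw [ind_true h0c, ind_false (not_not.2 h0c), zero_mul, add_zero]
      refine le_trans ?_ (Finset.single_le_sum (fun v _ => hnn v) (zero_mem_Lam n))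
      rw [hno, ind_true ((armT _).2 (conn1 0 h0c (zero_mem_Lam n)))]
      norm_num
    · rw [ind_false h0c, ind_true h0c, one_mul, zero_add]
      refine le_trans ?_ (Finset.sum_le_sum_of_subset_of_nonneg (Finset.filter_subset (· ∈ cl (T ω)) _) (fun v _ _ => hnn v))
      apply Finset.sum_le_sum
      intro v hv
      rw [Finset.mem_filter] at hv
      rw [hno, sub_zero]
      apply ind_mono
      rintro ⟨x, hx, hr, hc⟩
      rw [armT]
      obtain ⟨b, hb, hbv⟩ := conn1 v hv.2 hv.1
      refine ⟨b, hb, ?_⟩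
      have hc' : Conn Star (insert v ω ∩ ↑(Lam n)) 0 x := by
        apply hc.mono
        rintro w ⟨h2, h3, _⟩
        exact ⟨Set.mem_insert_of_mem _ h2, h3⟩
      have hxv : Conn Star (insert v ω ∩ ↑(Lam n)) v x :=
        (Conn.refl hbv.mem_right).tail (star_symm _ _ hr) hc'.mem_right
      exact (hbv.trans hxv).trans (hc'.symm star_symm)
  refine le_trans ?_ step
  have := E_explore_le h0 h1 (Finset.Subset.refl (Lam n)) Star (bd n) (fun t _ => (1 / 9) * ind (0 ∉ t)) g ?_ ?_ ?_
  · refine le_trans (le_of_eq ?_) this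
    rw [E_mul_left]
    congr 1
    have : ∀ ω, ind (0 ∉ T ω) = 1 - ind (Arm Star n 0 ω) := by
      intro ω; rw [ind_not, ind_congr (armT ω)]
    rw [E_congr q (Lam n) (fun ω _ => this ω), E_sub, E_const]
    rfl
  · intro t _ ω; rfl
  · intro t _ ω
    simp only [g]
    rw [Set.inter_assoc, Set.inter_self]
  · intro t _
    simp only [g]
    rw [E_const, E_mul_left, mul_comm]
    apply mul_le_mul_of_nonneg_left _ (ind_nonneg _)
    rw [E_add, E_const, E_mul_left, E_sum]
    by_cases h0c : 0 ∈ cl t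
    · rw [ind_true h0c, ind_false (not_not.2 h0c), zero_mul]; norm_num
    rw [ind_false h0c, ind_true h0c, one_mul, zero_add]
    set S := (Lam n).filter (· ∉ cl t) with hS
    have hSset : (↑(Lam n) \ cl t : Set (ℤ × ℤ)) = ↑S := by
      ext v; simp [hS]
    have hSL : S ⊆ Lam n := Finset.filter_subset _ _
    have h0S : (0 : ℤ × ℤ) ∈ S := Finset.mem_filter.2 ⟨zero_mem_Lam n, h0c⟩
    have hph := hphi S h0S
    rw [hSset]
    have e1 : ∀ v, E q (Lam n) (fun ω => (1 / 9) * ∑ x ∈ S.filter (fun x => Star x v), ind (Conn Star (ω ∩ ↑S) 0 x)) ≤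
        E q (Lam n) (fun ω => ind (∃ x, x ∉ cl t ∧ Star x v ∧ Conn Star (ω ∩ ↑S) 0 x)) := by
      intro v
      apply E_mono h0 h1
      intro ω _
      by_cases hex : ∃ x, x ∉ cl t ∧ Star x v ∧ Conn Star (ω ∩ ↑S) 0 x
      · rw [ind_true hex]
        have : ∑ x ∈ S.filter (fun x => Star x v), ind (Conn Star (ω ∩ ↑S) 0 x) ≤ ∑ x ∈ S.filter (fun x => Star x v), (1 : ℝ) :=
          Finset.sum_le_sum (fun x _ => ind_le_one _)
        rw [Finset.sum_const, nsmul_eq_mul, mul_one] at this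
        have c9 : (S.filter (fun x => Star x v)).card ≤ 9 := by
          rw [← card_NB v]
          apply Finset.card_le_card
          intro x hx
          exact mem_NB.2 (star_symm _ _ (Finset.mem_filter.1 hx).2)
        have c9' : ((S.filter (fun x => Star x v)).card : ℝ) ≤ 9 := by exact_mod_cast c9
        linarith
      · rw [ind_false hex, Finset.sum_eq_zero, mul_zero]
        intro x hx
        apply ind_false
        intro hc
        rw [Finset.mem_filter] at hx
        exact hex ⟨x, (Finset.mem_filter.1 hx.1).2, hx.2, hc⟩
    refine le_trans ?_ (Finset.sum_le_sum (fun v _ => e1 v))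
    have e2 : ∀ x, E q (Lam n) (fun ω => ind (Conn Star (ω ∩ ↑S) 0 x)) = E q S (fun ω => ind (Conn Star (ω ∩ ↑S) 0 x)) := by
      intro x
      apply E_dep q hSL
      exact (dep_inter (fun ω => Conn Star ω 0 x) _).ind
    simp only [E_mul_left, E_sum, e2]
    rw [← Finset.mul_sum]
    have : phi q S ≤ ∑ v ∈ (Lam n).filter (· ∈ cl t), ∑ x ∈ S.filter (fun x => Star x v), E q S (fun ω => ind (Conn Star (ω ∩ ↑S) 0 x)) := by
      rw [phi]
      simp only [Finset.sum_filter (s := S)]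
      rw [Finset.sum_comm]
      apply Finset.sum_le_sum
      intro x hx
      rw [← Finset.sum_filter]
      apply Finset.sum_le_sum_of_subset_of_nonneg
      · intro y hy
        rw [Finset.mem_sdiff, mem_NB] at hy
        have hxS := Finset.mem_filter.1 hx
        have hxb : x ∉ bd n := fun hb => hxS.2 (Or.inr ⟨hxS.1, Or.inl hb⟩)
        have hyL : y ∈ Lam n := by
          have h2 := mem_Lam.1 hxS.1
          have h3 := (star_iff _ _).1 hy.1
          have h4 : ¬ (x.1 = n ∨ x.1 = -(n : ℤ) ∨ x.2 = n ∨ x.2 = -(n : ℤ)) := fun h => hxb ⟨hxS.1, h⟩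
          rw [mem_Lam]
          omega
        rw [Finset.mem_filter, Finset.mem_filter]
        refine ⟨⟨hyL, ?_⟩, hy.1⟩
        by_contra hyc
        exact hy.2 (Finset.mem_filter.2 ⟨hyL, hyc⟩)
      · intro _ _ _; exact E_nonneg h0 h1 _ (fun _ => ind_nonneg _)
    linarith

lemma dct {q1 q2 : ℝ} (h0 : 0 ≤ q1) (h : q1 < q2) (h1 : q2 ≤ 1)
    (hphi : ∀ S : Finset (ℤ × ℤ), 0 ∈ S → 1 ≤ phi q1 S) (n : ℕ) :
    1 - Real.exp (-(q2 - q1) / 9) ≤ theta Star n q2 := by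
  set F : ℝ → ℝ := fun q => (1 - theta Star n q) * Real.exp (q / 9) with hF
  have hd : ∀ q, HasDerivAt F (-(∑ v ∈ Lam n, E q (Lam n) (fun ω => ind (Arm Star n 0 (insert v ω)) - ind (Arm Star n 0 (ω \ {v})))) * Real.exp (q / 9)
      + (1 - theta Star n q) * (Real.exp (q / 9) * (1 / 9))) q := by
    intro q
    have d1 := (E_russo (Lam n) (fun ω => ind (Arm Star n 0 ω)) q).const_sub 1
    have d2 : HasDerivAt (fun q : ℝ => Real.exp (q / 9)) (Real.exp (q / 9) * (1 / 9)) q :=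
      ((hasDerivAt_id q).div_const 9).exp
    exact d1.mul d2
  have anti : AntitoneOn F (Set.Icc q1 q2) := by
    apply antitoneOn_of_deriv_nonpos (convex_Icc _ _)
    · exact fun q _ => (hd q).continuousAt.continuousWithinAt
    · exact fun q _ => (hd q).differentiableAt.differentiableWithinAt
    · intro q hq
      rw [interior_Icc] at hq
      rw [(hd q).deriv]
      have h2 := theta_deriv (q := q) (by linarith [hq.1]) (by linarith [hq.2])
        (fun S hS => (hphi S hS).trans (phi_mono h0 hq.1.le (by linarith [hq.2]) S)) n
      have h3 := Real.exp_pos (q / 9)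
      nlinarith
  have h2 := anti (Set.left_mem_Icc.2 h.le) (Set.right_mem_Icc.2 h.le) h.le
  simp only [hF] at h2
  have h3 := theta_nonneg Star n h0 (h.le.trans h1)
  have h4 : (1 - theta Star n q2) * Real.exp (q2 / 9) ≤ Real.exp (q1 / 9) := by
    have := Real.exp_pos (q1 / 9)
    nlinarith
  have h5 : Real.exp (-(q2 - q1) / 9) * Real.exp (q2 / 9) = Real.exp (q1 / 9) := by
    rw [← Real.exp_add]; congr 1; ring
  have h6 := Real.exp_pos (q2 / 9)
  rw [← h5] at h4
  have := le_of_mul_le_mul_right h4 h6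
  linarith

end Perc

namespace Perc

/-! ### Arms from large boxes, landing on prescribed sides -/

/-- The box of radius `m` is connected to the boundary of the box of radius `N`. -/
def BoxArm (R : ℤ × ℤ → ℤ × ℤ → Prop) (m N : ℕ) (ω : Set (ℤ × ℤ)) : Prop :=
  ∃ u ∈ Lam m, ∃ v ∈ bd N, Conn R (ω ∩ ↑(Lam N)) u v

lemma BoxArm.mono {R : ℤ × ℤ → ℤ × ℤ → Prop} {m N : ℕ} {ω ω' : Set (ℤ × ℤ)} (h : BoxArm R m N ω) (hω : ω ⊆ ω') :
    BoxArm R m N ω' := by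
  obtain ⟨u, hu, v, hv, hc⟩ := h
  exact ⟨u, hu, v, hv, hc.mono (Set.inter_subset_inter_left _ hω)⟩

lemma theta_submult {R : ℤ × ℤ → ℤ × ℤ → Prop} (hR : Nice R) {q : ℝ} (h0 : 0 ≤ q) (h1 : q ≤ 1) {N N' : ℕ} (hN : N < N') :
    theta R N' q ≤ theta R N q * E q (Lam N') (fun ω => ind (BoxArm R (N + 1) N' ω)) := by
  classical
  have hLL : Lam N ⊆ Lam N' := Lam_mono hN.le
  have s1 : theta R N' q ≤ E q (Lam N') (fun ω => ind (Arm R N 0 ω) * ind (BoxArm R (N + 1) N' (ω \ ↑(Lam N)))) := by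
    apply E_mono h0 h1
    intro ω _
    rw [← ind_and]
    apply ind_mono
    rintro ⟨v, hv, hc⟩
    simp only [sub_zero] at hv hc
    have hvN : v ∉ Lam N := by
      intro h
      rw [mem_Lam] at h
      obtain ⟨_, h2⟩ := hv
      omega
    constructor
    · apply (arm_of_conn hR.star hc (Or.inl (by simpa using hvN))).mono Set.inter_subset_left
    · obtain ⟨a, b, ha, _, hr, hbv⟩ := hc.last_exit (↑(Lam N)) (zero_mem_Lam N) hvN
      refine ⟨b, ?_, v, hv, ?_⟩
      · have h2 := (star_iff _ _).1 (hR.star _ _ hr)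
        have h3 := mem_Lam.1 (Finset.mem_coe.1 ha)
        rw [mem_Lam]; push_cast; omega
      · apply hbv.mono
        rintro w ⟨⟨h2, h3⟩, h4⟩
        exact ⟨⟨h2, h4⟩, h3⟩
  refine s1.trans ?_
  rw [E_mul q hLL (S2 := Lam N' \ Lam N) Finset.sdiff_subset (Finset.disjoint_sdiff)]
  · rw [E_dep q hLL]
    · apply mul_le_mul_of_nonneg_left _ (theta_nonneg R N h0 h1)
      apply E_mono h0 h1
      intro ω _
      exact ind_mono (fun h => h.mono Set.sdiff_subset)
    · apply Dep.ind
      apply (arm_dep R N 0).mono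
      intro v hv; simpa using hv
  · apply Dep.ind
    apply (arm_dep R N 0).mono
    intro v hv; simpa using hv
  · apply Dep.ind
    intro ω
    simp only [BoxArm]
    have : (ω ∩ ↑(Lam N' \ Lam N)) \ ↑(Lam N) ∩ ↑(Lam N') = ω \ ↑(Lam N) ∩ ↑(Lam N') := by
      ext v; simp; tauto
    rw [this]

lemma arms_to_one {R : ℤ × ℤ → ℤ × ℤ → Prop} (hR : Nice R) {q : ℝ} (h0 : 0 ≤ q) (h1 : q ≤ 1) {c : ℝ} (hc : 0 < c)
    (hθ : ∀ n, c ≤ theta R n q) {ε : ℝ} (hε : 0 < ε) :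
    ∃ m : ℕ, ∀ N, m ≤ N → 1 - ε ≤ E q (Lam N) (fun ω => ind (BoxArm R m N ω)) := by
  set I := ⨅ n, theta R n q with hI
  have hbdd : BddBelow (Set.range fun n => theta R n q) := ⟨c, by rintro _ ⟨n, rfl⟩; exact hθ n⟩
  have hcI : c ≤ I := le_ciInf hθ
  have hlt : I < I + ε * I := by nlinarith
  obtain ⟨N0, hN0⟩ := exists_lt_of_ciInf_lt (f := fun n => theta R n q) hlt
  refine ⟨N0 + 1, fun N hN => ?_⟩
  have h2 := theta_submult hR h0 h1 (show N0 < N by omega)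
  have h3 : I ≤ theta R N q := ciInf_le hbdd N
  set P := E q (Lam N) (fun ω => ind (BoxArm R (N0 + 1) N ω))
  have hP0 : 0 ≤ P := E_nonneg h0 h1 _ (fun _ => ind_nonneg _)
  have h4 : I ≤ (I + ε * I) * P := h3.trans (h2.trans (mul_le_mul_of_nonneg_right hN0.le hP0))
  have hIpos : 0 < I := by linarith
  have h5 : 1 ≤ (1 + ε) * P := by
    by_contra hlt
    push Not at hlt
    nlinarith
  have hP1 : P ≤ 1 := E_ind_le_one h0 h1 _ _
  nlinarith

/-- Arm to a side determined by the functional `f`. -/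
def SA (R : ℤ × ℤ → ℤ × ℤ → Prop) (m N : ℕ) (f : ℤ × ℤ → ℤ) (ω : Set (ℤ × ℤ)) : Prop :=
  ∃ u ∈ Lam m, ∃ v ∈ Lam N, f v = N ∧ Conn R (ω ∩ ↑(Lam N)) u v

lemma SA.mono {R : ℤ × ℤ → ℤ × ℤ → Prop} {m N : ℕ} {f : ℤ × ℤ → ℤ} {ω ω' : Set (ℤ × ℤ)} (h : SA R m N f ω) (hω : ω ⊆ ω') :
    SA R m N f ω' := by
  obtain ⟨u, hu, v, hv, hf, hc⟩ := h
  exact ⟨u, hu, v, hv, hf, hc.mono (Set.inter_subset_inter_left _ hω)⟩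

lemma sa_dep (R : ℤ × ℤ → ℤ × ℤ → Prop) (m N : ℕ) (f : ℤ × ℤ → ℤ) : Dep (SA R m N f) ↑(Lam N) :=
  dep_inter (fun ω => ∃ u ∈ Lam m, ∃ v ∈ Lam N, f v = N ∧ Conn R ω u v) _

/-- Rotation by a quarter turn. -/
def rot : (ℤ × ℤ) ≃ (ℤ × ℤ) where
  toFun v := (-v.2, v.1)
  invFun v := (v.2, -v.1)
  left_inv v := by simp
  right_inv v := by simp

lemma rot_apply (v : ℤ × ℤ) : rot v = (-v.2, v.1) := rfl

lemma rot_symm_apply (v : ℤ × ℤ) : rot.symm v = (v.2, -v.1) := rfl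

lemma Lam_rot (N : ℕ) : (Lam N).map rot.toEmbedding = Lam N := by
  ext v
  rw [Finset.mem_map_equiv, rot_symm_apply, mem_Lam, mem_Lam]
  simp only
  omega

lemma mem_rot_Lam (N : ℕ) (v : ℤ × ℤ) : rot v ∈ Lam N ↔ v ∈ Lam N := by
  rw [rot_apply, mem_Lam, mem_Lam]
  simp only
  omega

lemma rot_image_inter (N : ℕ) (ω : Set (ℤ × ℤ)) : rot '' ω ∩ ↑(Lam N) = rot '' (ω ∩ ↑(Lam N)) := by
  ext v
  simp only [Set.mem_inter_iff, Set.mem_image, Finset.mem_coe]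
  constructor
  · rintro ⟨⟨w, hw, rfl⟩, h⟩; exact ⟨w, ⟨hw, (mem_rot_Lam N w).1 h⟩, rfl⟩
  · rintro ⟨w, ⟨hw, h⟩, rfl⟩; exact ⟨⟨w, hw, rfl⟩, (mem_rot_Lam N w).2 h⟩

lemma E_SA_rot {R : ℤ × ℤ → ℤ × ℤ → Prop} (hR : Nice R) {q : ℝ} (h0 : 0 ≤ q) (h1 : q ≤ 1) (m N : ℕ) (f : ℤ × ℤ → ℤ) :
    E q (Lam N) (fun ω => ind (SA R m N (f ∘ rot) ω)) ≤ E q (Lam N) (fun ω => ind (SA R m N f ω)) := by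
  conv_rhs => rw [← Lam_rot N, E_map]
  apply E_mono h0 h1
  intro ω _
  apply ind_mono
  rintro ⟨u, hu, v, hv, hf, hc⟩
  refine ⟨rot u, (mem_rot_Lam _ _).2 hu, rot v, (mem_rot_Lam _ _).2 hv, hf, ?_⟩
  rw [rot_image_inter]
  exact hc.map rot (fun a b h => hR.rot a b h)

def f1 : ℤ × ℤ → ℤ := fun v => v.1
def f2 : ℤ × ℤ → ℤ := fun v => -v.2
def f3 : ℤ × ℤ → ℤ := fun v => -v.1
def f4 : ℤ × ℤ → ℤ := fun v => v.2

lemma sides {R : ℤ × ℤ → ℤ × ℤ → Prop} (hR : Nice R) {q : ℝ} (h0 : 0 ≤ q) (h1 : q ≤ 1) (m N : ℕ)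
    (h : 1 - (1 / 10 : ℝ) ^ 4 ≤ E q (Lam N) (fun ω => ind (BoxArm R m N ω))) :
    ∀ f, (f = f1 ∨ f = f2 ∨ f = f3 ∨ f = f4) → 9 / 10 ≤ E q (Lam N) (fun ω => ind (SA R m N f ω)) := by
  have e1 : f1 ∘ rot = f2 := by ext v; simp [f1, f2, rot_apply]
  have e2 : f2 ∘ rot = f3 := by ext v; simp [f2, f3, rot_apply]
  have e3 : f3 ∘ rot = f4 := by ext v; simp [f3, f4, rot_apply]
  have e4 : f4 ∘ rot = f1 := by ext v; simp [f4, f1, rot_apply]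
  set s : (ℤ × ℤ → ℤ) → ℝ := fun f => E q (Lam N) (fun ω => ind (SA R m N f ω)) with hs
  have s1 : s f2 ≤ s f1 := e1 ▸ E_SA_rot hR h0 h1 m N f1
  have s2 : s f3 ≤ s f2 := e2 ▸ E_SA_rot hR h0 h1 m N f2
  have s3 : s f4 ≤ s f3 := e3 ▸ E_SA_rot hR h0 h1 m N f3
  have s4 : s f1 ≤ s f4 := e4 ▸ E_SA_rot hR h0 h1 m N f4
  let a : (ℤ × ℤ → ℤ) → Set (ℤ × ℤ) → ℝ := fun f ω => 1 - ind (SA R m N f ω)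
  have ha : ∀ f, Antitone (a f) := by
    intro f ω ω' hω
    have := ind_mono (Q := SA R m N f ω) (Q' := SA R m N f ω') (fun h => h.mono hω)
    simp only [a]; linarith
  have ha0 : ∀ f ω, 0 ≤ a f ω := by
    intro f ω
    have := ind_le_one (SA R m N f ω)
    simp only [a]; linarith
  have hE : ∀ f, E q (Lam N) (a f) = 1 - s f := by
    intro f; simp only [a, hs]; rw [E_sub, E_const]
  have anti_mul : ∀ F G : Set (ℤ × ℤ) → ℝ, Antitone F → Antitone G → (∀ ω, 0 ≤ F ω) → (∀ ω, 0 ≤ G ω) →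
      Antitone (fun ω => F ω * G ω) := by
    intro F G hF hG hF0 hG0 x y hxy
    exact mul_le_mul (hF hxy) (hG hxy) (hG0 _) (hF0 _)
  have p1 := harris_anti h0 h1 (Lam N) (a f1) (a f2) (ha _) (ha _)
  have p2 := harris_anti h0 h1 (Lam N) (a f3) (a f4) (ha _) (ha _)
  have p3 := harris_anti h0 h1 (Lam N) _ _ (anti_mul _ _ (ha f1) (ha f2) (ha0 _) (ha0 _))
    (anti_mul _ _ (ha f3) (ha f4) (ha0 _) (ha0 _))
  have p4 : E q (Lam N) (fun ω => a f1 ω * a f2 ω * (a f3 ω * a f4 ω)) ≤ E q (Lam N) (fun ω => 1 - ind (BoxArm R m N ω)) := by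
    apply E_mono h0 h1
    intro ω _
    by_cases hB : BoxArm R m N ω
    · have : a f1 ω = 0 ∨ a f2 ω = 0 ∨ a f3 ω = 0 ∨ a f4 ω = 0 := by
        obtain ⟨u, hu, v, ⟨hv, hv'⟩, hc⟩ := hB
        simp only [a]
        rcases hv' with h | h | h | h
        · left; rw [ind_true ⟨u, hu, v, hv, h, hc⟩, sub_self]
        · right; right; left; rw [ind_true ⟨u, hu, v, hv, by simp only [f3]; omega, hc⟩, sub_self]
        · right; right; right; rw [ind_true ⟨u, hu, v, hv, h, hc⟩, sub_self]
        · right; left; rw [ind_true ⟨u, hu, v, hv, by simp only [f2]; omega, hc⟩, sub_self]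
      rw [ind_true hB, sub_self]
      rcases this with h | h | h | h <;> simp [h]
    · rw [ind_false hB, sub_zero]
      have l1 : ∀ f, a f ω ≤ 1 := fun f => by simp only [a]; linarith [ind_nonneg (SA R m N f ω)]
      exact mul_le_one₀ (mul_le_one₀ (l1 _) (ha0 _ _) (l1 _)) (mul_nonneg (ha0 _ _) (ha0 _ _)) (mul_le_one₀ (l1 _) (ha0 _ _) (l1 _))
  rw [E_sub, E_const] at p4
  rw [hE, hE] at p1 p2
  have n1 : 0 ≤ 1 - s f1 := by rw [← hE]; exact E_nonneg h0 h1 _ (ha0 _)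
  have q2 : s f2 = s f1 := by linarith
  have q3 : s f3 = s f1 := by linarith
  have q4 : s f4 = s f1 := by linarith
  rw [q2] at p1
  rw [q3, q4] at p2
  have n2 : 0 ≤ (1 - s f1) * (1 - s f1) := mul_nonneg n1 n1
  have p5 : (1 - s f1) ^ 4 ≤ (1 / 10) ^ 4 := by
    have := (mul_le_mul p1 p2 n2 (n2.trans p1)).trans (p3.trans p4)
    calc (1 - s f1) ^ 4 = (1 - s f1) * (1 - s f1) * ((1 - s f1) * (1 - s f1)) := by ring
      _ ≤ _ := this
      _ ≤ _ := by linarith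
  have p6 : 1 - s f1 ≤ 1 / 10 := le_of_pow_le_pow_left₀ (by norm_num) (by norm_num) p5
  rintro f (rfl | rfl | rfl | rfl)
  · change 9 / 10 ≤ s f1; linarith
  · change 9 / 10 ≤ s f2; linarith
  · change 9 / 10 ≤ s f3; linarith
  · change 9 / 10 ≤ s f4; linarith

end Perc

namespace Perc

/-! ### Local uniqueness -/

section Abstract
variable {V : Type*} [DecidableEq V]

/-- `b` is the leader of its cluster among the boundary sites. -/
def Leader (R : V → V → Prop) (Γ D : Finset V) (idx : V → ℕ) (ω : Set V) (b : V) : Prop :=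
  b ∈ ω ∧ ∀ b' ∈ D, Conn R (ω ∩ ↑Γ) b b' → idx b ≤ idx b'

open Classical in
noncomputable def leaders (R : V → V → Prop) (Γ D : Finset V) (idx : V → ℕ) (ω : Set V) : Finset V :=
  D.filter (Leader R Γ D idx ω)

/-- Number of clusters touching `D`. -/
noncomputable def nC (R : V → V → Prop) (Γ D : Finset V) (idx : V → ℕ) (ω : Set V) : ℝ :=
  (leaders R Γ D idx ω).card

variable {R : V → V → Prop} {Γ D : Finset V} {idx : V → ℕ}

lemma leaders_mono {ω ω' : Set V} (h : ω ⊆ ω') (hD : ∀ b ∈ D, b ∈ ω' → b ∈ ω) :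
    leaders R Γ D idx ω' ⊆ leaders R Γ D idx ω := by
  classical
  intro b hb
  unfold leaders at *
  rw [Finset.mem_filter] at *
  exact ⟨hb.1, hD b hb.1 hb.2.1, fun b' hb' hc => hb.2.2 b' hb' (hc.mono (Set.inter_subset_inter_left _ h))⟩

lemma nC_anti {ω ω' : Set V} (h : ω ⊆ ω') (hD : ∀ b ∈ D, b ∈ ω' → b ∈ ω) :
    nC R Γ D idx ω' ≤ nC R Γ D idx ω := by
  unfold nC
  exact_mod_cast Finset.card_le_card (leaders_mono h hD)

lemma nC_le (ω : Set V) : nC R Γ D idx ω ≤ D.card := by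
  classical
  unfold nC leaders
  exact_mod_cast Finset.card_filter_le _ _

lemma nC_nonneg (ω : Set V) : 0 ≤ nC R Γ D idx ω := by unfold nC; positivity

lemma nC_insert_le (v : V) (ω : Set V) : nC R Γ D idx (insert v ω) ≤ nC R Γ D idx (ω \ {v}) + 1 := by
  classical
  have : leaders R Γ D idx (insert v ω) ⊆ insert v (leaders R Γ D idx (ω \ {v})) := by
    intro b hb
    rw [Finset.mem_insert]
    by_cases hbv : b = v
    · exact Or.inl hbv
    right
    unfold leaders at *
    rw [Finset.mem_filter] at *
    refine ⟨hb.1, ⟨hb.2.1.resolve_left hbv, hbv⟩, fun b' hb' hc => hb.2.2 b' hb' (hc.mono ?_)⟩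
    exact Set.inter_subset_inter_left _ (Set.sdiff_subset.trans (Set.subset_insert _ _))
  have h2 := (Finset.card_le_card this).trans (Finset.card_insert_le _ _)
  unfold nC
  exact_mod_cast h2

/-- Two distinct clusters that touch both `W` and `D`. -/
def TwoA (R : V → V → Prop) (Γ D W : Finset V) (ω : Set V) : Prop :=
  ∃ u ∈ W, ∃ v ∈ W, ∃ a ∈ D, ∃ b ∈ D, Conn R (ω ∩ ↑Γ) u a ∧ Conn R (ω ∩ ↑Γ) v b ∧ ¬ Conn R (ω ∩ ↑Γ) u v

lemma exists_leader (hR : ∀ a b, R a b → R b a) {ω : Set V} {a : V} (ha : a ∈ D) (hω : a ∈ ω ∩ ↑Γ) :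
    ∃ l ∈ leaders R Γ D idx ω, Conn R (ω ∩ ↑Γ) a l := by
  classical
  obtain ⟨l, hl, hmin⟩ := Finset.exists_min_image (D.filter (fun b => Conn R (ω ∩ ↑Γ) a b)) idx
    ⟨a, Finset.mem_filter.2 ⟨ha, Conn.refl hω⟩⟩
  rw [Finset.mem_filter] at hl
  refine ⟨l, ?_, hl.2⟩
  unfold leaders
  rw [Finset.mem_filter]
  exact ⟨hl.1, hl.2.mem_right.1, fun b' hb' hc => hmin b' (Finset.mem_filter.2 ⟨hb', hl.2.trans hc⟩)⟩

lemma nC_two (hR : ∀ a b, R a b → R b a) (hidx : Function.Injective idx) {W : Finset V} (hWD : Disjoint W D)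
    (hWc : ∀ u ∈ W, ∀ v ∈ W, Conn R (↑W ∩ ↑Γ) u v) {ω : Set V} (h : TwoA R Γ D W ω) :
    nC R Γ D idx (ω ∪ ↑W) + 1 ≤ nC R Γ D idx ω := by
  classical
  obtain ⟨u, hu, v, hv, a, ha, b, hb, hua, hvb, huv⟩ := h
  obtain ⟨l, hl, hal⟩ := exists_leader (idx := idx) hR ha hua.mem_right
  obtain ⟨k, hk, hbk⟩ := exists_leader (idx := idx) hR hb hvb.mem_right
  have hlk : l ≠ k := by
    rintro rfl
    exact huv ((hua.trans hal).trans (((hvb.trans hbk)).symm hR))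
  have hsub : leaders R Γ D idx (ω ∪ ↑W) ⊆ leaders R Γ D idx ω := by
    apply leaders_mono Set.subset_union_left
    rintro c hc (h | h)
    · exact h
    · exact absurd hc (Finset.disjoint_left.1 hWD h)
  have hss : leaders R Γ D idx (ω ∪ ↑W) ⊂ leaders R Γ D idx ω := by
    refine Finset.ssubset_iff_subset_ne.2 ⟨hsub, fun he => ?_⟩
    have m1 : (ω ∩ ↑Γ : Set V) ⊆ (ω ∪ ↑W) ∩ ↑Γ := Set.inter_subset_inter_left _ Set.subset_union_left
    have m2 : (↑W ∩ ↑Γ : Set V) ⊆ (ω ∪ ↑W) ∩ ↑Γ := Set.inter_subset_inter_left _ Set.subset_union_right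
    have clk : Conn R ((ω ∪ ↑W) ∩ ↑Γ) l k :=
      ((((hua.trans hal).mono m1).symm hR).trans ((hWc u hu v hv).mono m2)).trans ((hvb.trans hbk).mono m1)
    have hlD : l ∈ D := by unfold leaders at hl; exact (Finset.mem_filter.1 hl).1
    have hkD : k ∈ D := by unfold leaders at hk; exact (Finset.mem_filter.1 hk).1
    rw [← he] at hl hk
    unfold leaders at hl hk
    have i1 := (Finset.mem_filter.1 hl).2.2 k hkD clk
    have i2 := (Finset.mem_filter.1 hk).2.2 l hlD (clk.symm hR)
    exact hlk (hidx (le_antisymm i1 i2))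
  have := Finset.card_lt_card hss
  unfold nC
  exact_mod_cast this

lemma E_union_le {p : ℝ} (h0 : 0 ≤ p) (h1 : p ≤ 1) (S W : Finset V) (hW : W ⊆ S) (G : Set V → ℝ) (hG : ∀ ω, 0 ≤ G ω) :
    p ^ W.card * E p S (fun ω => G (ω ∪ ↑W)) ≤ E p S G := by
  induction W using Finset.induction_on generalizing G with
  | empty => simp
  | insert a W ha ih =>
    rw [Finset.insert_subset_iff] at hW
    rw [Finset.card_insert_of_notMem ha, pow_succ', mul_assoc]
    have h2 := ih hW.2 (fun ω => G (insert a ω)) (fun ω => hG _)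
    have h3 := E_split p hW.1 G
    have h4 : 0 ≤ E p S (fun ω => G (ω \ {a})) := E_nonneg h0 h1 _ (fun _ => hG _)
    have h5 : E p S (fun ω => G (ω ∪ ↑(insert a W))) = E p S (fun ω => G (insert a (ω ∪ ↑W))) := by
      apply E_congr; intro ω _; congr 1; ext v; simp
    rw [h5, h3]
    have := mul_le_mul_of_nonneg_left h2 h0
    nlinarith

lemma telescope {p : ℝ} (h0 : 0 ≤ p) (h1 : p ≤ 1) {W : Finset V} (hWD : Disjoint W D) (hW : W ⊆ Γ) :
    p ^ W.card * E p Γ (fun ω => nC R Γ D idx ω - nC R Γ D idx (ω ∪ ↑W)) ≤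
      ∑ w ∈ W, E p Γ (fun ω => nC R Γ D idx (ω \ {w}) - nC R Γ D idx (insert w ω)) := by
  induction W using Finset.induction_on with
  | empty => simp [E_const]
  | insert a W ha ih =>
    rw [Finset.insert_subset_iff] at hW
    rw [Finset.disjoint_insert_left] at hWD
    have ih' := ih hWD.2 hW.2
    rw [Finset.card_insert_of_notMem ha, pow_succ', Finset.sum_insert ha]
    have mono1 : ∀ ω : Set V, nC R Γ D idx (insert a ω) ≤ nC R Γ D idx ω := by
      intro ω
      apply nC_anti (Set.subset_insert _ _)
      rintro b hb (rfl | h)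
      · exact absurd hb hWD.1
      · exact h
    have mono2 : ∀ ω : Set V, nC R Γ D idx ω ≤ nC R Γ D idx (ω \ {a}) := by
      intro ω
      apply nC_anti Set.sdiff_subset
      intro b hb h
      refine ⟨h, ?_⟩
      rintro rfl
      exact hWD.1 hb
    have g1 := E_union_le h0 h1 Γ W hW.2 (fun ω => nC R Γ D idx ω - nC R Γ D idx (insert a ω))
      (fun ω => sub_nonneg.2 (mono1 ω))
    have g2 : E p Γ (fun ω => nC R Γ D idx ω - nC R Γ D idx (insert a ω)) ≤
        E p Γ (fun ω => nC R Γ D idx (ω \ {a}) - nC R Γ D idx (insert a ω)) := by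
      apply E_mono h0 h1; intro ω _; linarith [mono2 ω]
    have g3 : E p Γ (fun ω => nC R Γ D idx ω - nC R Γ D idx (ω ∪ ↑(insert a W))) =
        E p Γ (fun ω => nC R Γ D idx ω - nC R Γ D idx (ω ∪ ↑W)) +
        E p Γ (fun ω => nC R Γ D idx (ω ∪ ↑W) - nC R Γ D idx (insert a (ω ∪ ↑W))) := by
      rw [← E_add]
      apply E_congr; intro ω _
      have : ω ∪ ↑(insert a W) = insert a (ω ∪ ↑W) := by ext v; simp
      rw [this]; ring
    rw [g3]
    have n1 : 0 ≤ E p Γ (fun ω => nC R Γ D idx ω - nC R Γ D idx (ω ∪ ↑W)) := by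
      apply E_nonneg h0 h1; intro ω
      refine sub_nonneg.2 (nC_anti Set.subset_union_left ?_)
      rintro b hb (h | h)
      · exact h
      · exact absurd hb (Finset.disjoint_left.1 hWD.2 h)
    have n2 : 0 ≤ E p Γ (fun ω => nC R Γ D idx (ω ∪ ↑W) - nC R Γ D idx (insert a (ω ∪ ↑W))) := by
      apply E_nonneg h0 h1; intro ω
      exact sub_nonneg.2 (mono1 _)
    have n3 : 0 ≤ p ^ W.card := by positivity
    have k1 : p * p ^ W.card ≤ p ^ W.card := mul_le_of_le_one_left n3 h1
    calc p * p ^ W.card * (_ + _) ≤ p ^ W.card * (E p Γ (fun ω => nC R Γ D idx ω - nC R Γ D idx (ω ∪ ↑W)) +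
        E p Γ (fun ω => nC R Γ D idx (ω ∪ ↑W) - nC R Γ D idx (insert a (ω ∪ ↑W)))) :=
          mul_le_mul_of_nonneg_right k1 (add_nonneg n1 n2)
      _ ≤ _ := by rw [mul_add]; linarith

lemma two_bound (hR : ∀ a b, R a b → R b a) (hidx : Function.Injective idx) {p : ℝ} (h0 : 0 ≤ p) (h1 : p ≤ 1)
    {W : Finset V} (hWD : Disjoint W D) (hW : W ⊆ Γ) (hWc : ∀ u ∈ W, ∀ v ∈ W, Conn R (↑W ∩ ↑Γ) u v) :
    p ^ W.card * E p Γ (fun ω => ind (TwoA R Γ D W ω)) ≤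
      ∑ w ∈ W, E p Γ (fun ω => nC R Γ D idx (ω \ {w}) - nC R Γ D idx (insert w ω)) := by
  refine le_trans ?_ (telescope h0 h1 hWD hW)
  apply mul_le_mul_of_nonneg_left _ (by positivity)
  apply E_mono h0 h1
  intro ω _
  by_cases h : TwoA R Γ D W ω
  · rw [ind_true h]; linarith [nC_two (idx := idx) hR hidx hWD hWc h]
  · rw [ind_false h]
    refine sub_nonneg.2 (nC_anti Set.subset_union_left ?_)
    rintro b hb (h | h)
    · exact h
    · exact absurd hb (Finset.disjoint_left.1 hWD h)

/-- The total expected drop at interior sites. -/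
noncomputable def TT (R : V → V → Prop) (Γ D : Finset V) (idx : V → ℕ) (p : ℝ) : ℝ :=
  ∑ w ∈ Γ \ D, E p Γ (fun ω => nC R Γ D idx (ω \ {w}) - nC R Γ D idx (insert w ω))

lemma drop_nonneg {p : ℝ} (h0 : 0 ≤ p) (h1 : p ≤ 1) {w : V} (hw : w ∉ D) :
    0 ≤ E p Γ (fun ω => nC R Γ D idx (ω \ {w}) - nC R Γ D idx (insert w ω)) := by
  apply E_nonneg h0 h1
  intro ω
  refine sub_nonneg.2 (nC_anti (Set.sdiff_subset.trans (Set.subset_insert _ _)) ?_)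
  intro b hb h
  have : b ≠ w := fun e => hw (e ▸ hb)
  exact ⟨h.resolve_left this, this⟩

lemma nC_deriv {p : ℝ} (h0 : 0 ≤ p) (h1 : p ≤ 1) (hD : D ⊆ Γ) :
    ∑ v ∈ Γ, E p Γ (fun ω => nC R Γ D idx (insert v ω) - nC R Γ D idx (ω \ {v})) ≤ D.card - TT R Γ D idx p := by
  rw [← Finset.sum_sdiff hD]
  have a1 : ∑ v ∈ Γ \ D, E p Γ (fun ω => nC R Γ D idx (insert v ω) - nC R Γ D idx (ω \ {v})) = - TT R Γ D idx p := by
    rw [TT, ← Finset.sum_neg_distrib]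
    apply Finset.sum_congr rfl
    intro v _
    rw [E_sub, E_sub]; ring
  have a2 : ∑ v ∈ D, E p Γ (fun ω => nC R Γ D idx (insert v ω) - nC R Γ D idx (ω \ {v})) ≤ ∑ v ∈ D, (1 : ℝ) := by
    apply Finset.sum_le_sum
    intro v _
    rw [← E_const p Γ 1]
    apply E_mono h0 h1
    intro ω _
    linarith [nC_insert_le (R := R) (Γ := Γ) (D := D) (idx := idx) v ω]
  rw [Finset.sum_const, nsmul_eq_mul, mul_one] at a2
  linarith

lemma E_nC_bounds {p : ℝ} (h0 : 0 ≤ p) (h1 : p ≤ 1) :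
    0 ≤ E p Γ (nC R Γ D idx) ∧ E p Γ (nC R Γ D idx) ≤ D.card := by
  constructor
  · exact E_nonneg h0 h1 _ nC_nonneg
  · rw [← E_const p Γ (D.card : ℝ)]
    exact E_mono h0 h1 _ (fun ω _ => nC_le ω)

/-- A good parameter exists for both relations. -/
lemma good_param (R R' : V → V → Prop) (Γ D : Finset V) (idx : V → ℕ) (hD : D ⊆ Γ) {p1 p2 : ℝ} (h0 : 0 ≤ p1) (h12 : p1 < p2)
    (h1 : p2 ≤ 1) : ∃ p, p1 < p ∧ p < p2 ∧
      TT R Γ D idx p + TT R' Γ D idx (1 - p) ≤ 2 * D.card + 2 * D.card / (p2 - p1) := by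
  set H : ℝ → ℝ := fun p => E (1 - p) Γ (nC R' Γ D idx) - E p Γ (nC R Γ D idx) with hH
  have hd : ∀ p, HasDerivAt H (-(∑ v ∈ Γ, E (1 - p) Γ (fun ω => nC R' Γ D idx (insert v ω) - nC R' Γ D idx (ω \ {v})))
      - ∑ v ∈ Γ, E p Γ (fun ω => nC R Γ D idx (insert v ω) - nC R Γ D idx (ω \ {v}))) p := by
    intro p
    have d1 := E_russo Γ (nC R Γ D idx) p
    have d2 := E_russo Γ (nC R' Γ D idx) (1 - p)
    have d3 : HasDerivAt (fun p : ℝ => 1 - p) (-1) p := by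
      simpa using (hasDerivAt_id p).const_sub 1
    have d4 := d2.comp p d3
    have d5 := d4.sub d1
    exact d5.congr_deriv (by ring)
  obtain ⟨p, hp, hpe⟩ := exists_hasDerivAt_eq_slope H _ h12
    (fun q _ => (hd q).continuousAt.continuousWithinAt) (fun q _ => hd q)
  refine ⟨p, hp.1, hp.2, ?_⟩
  have b1 := nC_deriv (R := R) (idx := idx) (p := p) (by linarith [hp.1]) (by linarith [hp.2]) hD
  have b2 := nC_deriv (R := R') (idx := idx) (p := 1 - p) (by linarith [hp.2]) (by linarith [hp.1]) hD
  have c1 := E_nC_bounds (R := R) (Γ := Γ) (D := D) (idx := idx) (p := p1) h0 (by linarith)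
  have c2 := E_nC_bounds (R := R) (Γ := Γ) (D := D) (idx := idx) (p := p2) (by linarith) h1
  have c3 := E_nC_bounds (R := R') (Γ := Γ) (D := D) (idx := idx) (p := 1 - p1) (by linarith) (by linarith)
  have c4 := E_nC_bounds (R := R') (Γ := Γ) (D := D) (idx := idx) (p := 1 - p2) (by linarith) (by linarith)
  have c5 : (H p2 - H p1) / (p2 - p1) ≤ 2 * D.card / (p2 - p1) := by
    apply div_le_div_of_nonneg_right _ (by linarith)
    simp only [hH]
    linarith
  linarith

end Abstract

end Perc

namespace Perc

/-! ### Local uniqueness in boxes -/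

/-- Two distinct clusters joining the box of radius `m` around `x` to the boundary of the box of radius `N`. -/
def TwoX (R : ℤ × ℤ → ℤ × ℤ → Prop) (m N : ℕ) (x : ℤ × ℤ) (ω : Set (ℤ × ℤ)) : Prop :=
  ∃ u v a b, u - x ∈ Lam m ∧ v - x ∈ Lam m ∧ a - x ∈ bd N ∧ b - x ∈ bd N ∧
    Conn R (ω ∩ {w | w - x ∈ Lam N}) u a ∧ Conn R (ω ∩ {w | w - x ∈ Lam N}) v b ∧
    ¬ Conn R (ω ∩ {w | w - x ∈ Lam N}) u v

lemma twoX_dep (R : ℤ × ℤ → ℤ × ℤ → Prop) (m N : ℕ) (x : ℤ × ℤ) : Dep (TwoX R m N x) {w | w - x ∈ Lam N} := by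
  intro ω
  simp only [TwoX, Set.inter_assoc, Set.inter_self]

lemma twoX_tr {R : ℤ × ℤ → ℤ × ℤ → Prop} (hR : Nice R) (m N : ℕ) (x : ℤ × ℤ) (ω : Set (ℤ × ℤ)) :
    TwoX R m N x (tr x '' ω) ↔ TwoX R m N 0 ω := by
  unfold TwoX
  rw [tr_inter]
  simp only [sub_zero]
  have hset : {w | w ∈ Lam N} = (↑(Lam N) : Set (ℤ × ℤ)) := rfl
  rw [hset]
  constructor
  · rintro ⟨u, v, a, b, h1, h2, h3, h4, h5, h6, h7⟩
    refine ⟨u - x, v - x, a - x, b - x, h1, h2, h3, h4, ?_, ?_, ?_⟩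
    · rw [← conn_tr hR x]; simpa using h5
    · rw [← conn_tr hR x]; simpa using h6
    · rw [← conn_tr hR x]; simpa using h7
  · rintro ⟨u, v, a, b, h1, h2, h3, h4, h5, h6, h7⟩
    refine ⟨u + x, v + x, a + x, b + x, by simpa using h1, by simpa using h2, by simpa using h3, by simpa using h4, ?_, ?_, ?_⟩
    · rw [conn_tr hR x]; exact h5
    · rw [conn_tr hR x]; exact h6
    · rw [conn_tr hR x]; exact h7

lemma E_twoX {R : ℤ × ℤ → ℤ × ℤ → Prop} (hR : Nice R) (q : ℝ) (m N : ℕ) (x : ℤ × ℤ) {Λ : Finset (ℤ × ℤ)}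
    (h : LamT N x ⊆ Λ) : E q Λ (fun ω => ind (TwoX R m N x ω)) = E q (Lam N) (fun ω => ind (TwoX R m N 0 ω)) := by
  rw [E_dep q h]
  · rw [LamT, E_map]
    apply E_congr
    intro ω _
    exact ind_congr (twoX_tr hR m N x ω)
  · refine ((twoX_dep R m N x).ind).mono ?_
    intro w hw
    exact mem_LamT.2 hw

lemma conn_h {G : Set (ℤ × ℤ)} (a b y : ℤ) (hab : a ≤ b) (h : ∀ t, a ≤ t → t ≤ b → ((t, y) : ℤ × ℤ) ∈ G) :
    Conn Adjacent G (a, y) (b, y) := by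
  induction b, hab using Int.leInduction with
  | base => exact Conn.refl (h a le_rfl le_rfl)
  | succ b hb ih =>
    refine (ih (fun t h1 h2 => h t h1 (by omega))).tail ?_ (h (b + 1) (by omega) le_rfl)
    rw [adj_iff]; first | omega | simp | trace_state

lemma conn_v {G : Set (ℤ × ℤ)} (a b x : ℤ) (hab : a ≤ b) (h : ∀ t, a ≤ t → t ≤ b → ((x, t) : ℤ × ℤ) ∈ G) :
    Conn Adjacent G (x, a) (x, b) := by
  induction b, hab using Int.leInduction with
  | base => exact Conn.refl (h a le_rfl le_rfl)
  | succ b hb ih =>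
    refine (ih (fun t h1 h2 => h t h1 (by omega))).tail ?_ (h (b + 1) (by omega) le_rfl)
    rw [adj_iff]; first | omega | simp | trace_state

/-- Boxes are connected. -/
lemma box_conn (m : ℕ) (x u v : ℤ × ℤ) (hu : u ∈ LamT m x) (hv : v ∈ LamT m x) :
    Conn Adjacent (↑(LamT m x)) u v := by
  have key : ∀ u ∈ LamT m x, Conn Adjacent (↑(LamT m x)) (x.1 - m, x.2 - m) u := by
    intro u hu
    rw [mem_LamT, mem_Lam] at hu
    simp only [Prod.fst_sub, Prod.snd_sub] at hu
    have c1 : Conn Adjacent (↑(LamT m x)) (x.1 - m, x.2 - m) (u.1, x.2 - m) := by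
      apply conn_h
      · omega
      · intro t h1 h2
        rw [Finset.mem_coe, mem_LamT, mem_Lam]; simp only [Prod.fst_sub, Prod.snd_sub]; omega
    have c2 : Conn Adjacent (↑(LamT m x)) (u.1, x.2 - m) (u.1, u.2) := by
      apply conn_v
      · omega
      · intro t h1 h2
        rw [Finset.mem_coe, mem_LamT, mem_Lam]; simp only [Prod.fst_sub, Prod.snd_sub]; omega
    exact c1.trans c2
  exact ((key u hu).symm adj_symm).trans (key v hv)

lemma card_Lam (n : ℕ) : (Lam n).card = (2 * n + 1) ^ 2 := by
  rw [Lam, Finset.Icc_prod_def, Finset.card_product]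
  simp only [Int.card_Icc]
  rw [show ((n : ℤ) + 1 - -(n : ℤ)).toNat = 2 * n + 1 by omega]
  ring

lemma two_sum {R : ℤ × ℤ → ℤ × ℤ → Prop} (hR : Nice R) (idx : ℤ × ℤ → ℕ) (hidx : Function.Injective idx)
    {p : ℝ} (h0 : 0 ≤ p) (h1 : p ≤ 1) (m r : ℕ) :
    ((2 * r + 1 : ℕ) : ℝ) ^ 2 * (p ^ (Lam m).card * E p (Lam (2 * r + m + 2)) (fun ω => ind (TwoX R m (2 * r + m + 2) 0 ω))) ≤
      (Lam m).card * TT R (Lam (r + m + 1)) (Lam (r + m + 1) \ Lam (r + m)) idx p := by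
  set N := 2 * r + m + 2 with hN
  set Γ := Lam (r + m + 1) with hΓ
  set D := Lam (r + m + 1) \ Lam (r + m) with hD
  have hΓD : Γ \ D = Lam (r + m) := by
    rw [hΓ, hD, Finset.sdiff_sdiff_eq_self (Lam_mono (by omega))]
  set d : ℤ × ℤ → ℝ := fun w => E p Γ (fun ω => nC R Γ D idx (ω \ {w}) - nC R Γ D idx (insert w ω)) with hd
  have step : ∀ x ∈ Lam r, p ^ (Lam m).card * E p (Lam N) (fun ω => ind (TwoX R m N 0 ω)) ≤ ∑ s ∈ Lam m, d (s + x) := by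
    intro x hx
    rw [mem_Lam] at hx
    have hWsub : LamT m x ⊆ Lam (r + m) := by
      intro w hw
      rw [mem_LamT, mem_Lam] at hw
      rw [mem_Lam]
      simp only [Prod.fst_sub, Prod.snd_sub] at hw
      push_cast; omega
    have hW : LamT m x ⊆ Γ := hWsub.trans (Lam_mono (by omega))
    have hWD : Disjoint (LamT m x) D := by
      rw [Finset.disjoint_left]
      intro w hw hwD
      exact (Finset.mem_sdiff.1 hwD).2 (hWsub hw)
    have hΓN : Γ ⊆ LamT N x := by
      intro w hw
      rw [hΓ, mem_Lam] at hw
      rw [mem_LamT, mem_Lam]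
      simp only [Prod.fst_sub, Prod.snd_sub]
      push_cast at *; omega
    have tb := two_bound (R := R) (Γ := Γ) (D := D) (idx := idx) hR.symm hidx h0 h1 hWD hW (by
      intro u hu v hv
      refine ((box_conn m x u v hu hv).monoR hR.adj).mono ?_
      intro w hw; exact ⟨hw, hW hw⟩)
    have hc : (LamT m x).card = (Lam m).card := by rw [LamT, Finset.card_map]
    have hs : ∑ w ∈ LamT m x, d w = ∑ s ∈ Lam m, d (s + x) := by
      rw [LamT, Finset.sum_map]; rfl
    rw [hc, hs] at tb
    refine le_trans ?_ tb
    apply mul_le_mul_of_nonneg_left _ (by positivity)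
    rw [← E_twoX hR p m N x (Finset.Subset.refl _)]
    have hdep : Dep (fun ω : Set (ℤ × ℤ) => ind (TwoA R Γ D (LamT m x) ω)) ↑Γ := by
      apply Dep.ind
      intro ω
      simp only [TwoA, Set.inter_assoc, Set.inter_self]
    rw [← E_dep p hΓN _ hdep]
    apply E_mono h0 h1
    intro ω _
    apply ind_mono
    rintro ⟨u, v, a, b, hu, hv, ha, hb, hua, hvb, huv⟩
    have hsub : (ω ∩ ↑Γ : Set (ℤ × ℤ)) ⊆ ω ∩ {w | w - x ∈ Lam N} := by
      rintro w ⟨h1, h2⟩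
      exact ⟨h1, mem_LamT.1 (hΓN h2)⟩
    have exit : ∀ u a, u - x ∈ Lam m → a - x ∈ bd N → Conn R (ω ∩ {w | w - x ∈ Lam N}) u a →
        ∃ c ∈ D, Conn R (ω ∩ ↑Γ) u c := by
      intro u a hu ha hua
      have huΓ : u ∈ (↑Γ : Set (ℤ × ℤ)) := hW (mem_LamT.2 hu)
      rcases hua.first_exit ↑Γ huΓ with h | ⟨c, e, h, hce, he, heΓ⟩
      · exfalso
        have h2 : a ∈ Lam (r + m + 1) := h.mem_right.2
        rw [mem_Lam] at h2
        have h3 := ha.2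
        simp only [Prod.fst_sub, Prod.snd_sub] at h3
        push_cast at *
        omega
      · refine ⟨c, ?_, h.mono ?_⟩
        · have h2 : c ∈ Lam (r + m + 1) := h.mem_right.2
          rw [hD, Finset.mem_sdiff]
          refine ⟨h2, fun h4 => heΓ ?_⟩
          have h3 := hR.star _ _ hce
          rw [star_iff] at h3
          show e ∈ Lam (r + m + 1)
          rw [mem_Lam] at h4 ⊢
          push_cast at *
          omega
        · rintro w ⟨⟨h1, _⟩, h2⟩; exact ⟨h1, h2⟩
    obtain ⟨a', ha', hua'⟩ := exit u a hu ha hua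
    obtain ⟨b', hb', hvb'⟩ := exit v b hv hb hvb
    exact ⟨u, mem_LamT.2 hu, v, mem_LamT.2 hv, a', ha', b', hb', hua', hvb', fun h => huv (h.mono hsub)⟩
  have hsum := Finset.sum_le_sum step
  rw [Finset.sum_const, nsmul_eq_mul, card_Lam, Finset.sum_comm] at hsum
  have hle : ∀ s ∈ Lam m, ∑ x ∈ Lam r, d (s + x) ≤ TT R Γ D idx p := by
    intro s hs
    have : ∑ x ∈ Lam r, d (s + x) = ∑ w ∈ LamT r s, d w := by
      rw [LamT, Finset.sum_map]
      apply Finset.sum_congr rfl; intro x _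
      simp [add_comm]
    rw [this, TT, hΓD]
    apply Finset.sum_le_sum_of_subset_of_nonneg
    · intro w hw
      rw [mem_Lam] at hs
      rw [mem_LamT, mem_Lam] at hw
      rw [mem_Lam]
      simp only [Prod.fst_sub, Prod.snd_sub] at hw
      push_cast; omega
    · intro w hw _
      apply drop_nonneg h0 h1
      intro hwD
      exact (Finset.mem_sdiff.1 hwD).2 hw
  have h2 := hsum.trans (Finset.sum_le_sum hle)
  rw [Finset.sum_const, nsmul_eq_mul] at h2
  exact_mod_cast h2

set_option maxHeartbeats 1000000 in
/-- There are a scale and a parameter at which both models have local uniqueness. -/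
lemma unique_scale (m : ℕ) {δ p1 p2 : ℝ} (hδ : 0 < δ) (h0 : 0 < p1) (h12 : p1 < p2) (h1 : p2 < 1) :
    ∃ N p, m ≤ N ∧ p1 < p ∧ p < p2 ∧ E p (Lam N) (fun ω => ind (TwoX Adjacent m N 0 ω)) ≤ δ ∧
      E (1 - p) (Lam N) (fun ω => ind (TwoX Star m N 0 ω)) ≤ δ := by
  set c := min p1 (1 - p2) with hc
  have hc0 : 0 < c := lt_min h0 (by linarith)
  set M : ℝ := ((Lam m).card : ℝ) with hM
  set K : ℝ := M * (2 + 2 / (p2 - p1)) with hK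
  have hM0 : 0 ≤ M := by positivity
  have hK0 : 0 ≤ K := by
    have : 0 < p2 - p1 := by linarith
    positivity
  set δ' : ℝ := δ * c ^ (Lam m).card with hδ'
  have hδ'0 : 0 < δ' := by positivity
  obtain ⟨r0, hr0⟩ := exists_nat_ge (4 * K / δ')
  set r := max r0 (m + 1) with hr
  have hr1 : 4 * K ≤ δ' * r := by
    have : (r0 : ℝ) ≤ r := by exact_mod_cast le_max_left _ _
    rw [div_le_iff₀ hδ'0] at hr0
    nlinarith
  have hr2 : m + 1 ≤ r := le_max_right _ _
  set idx : ℤ × ℤ → ℕ := Encodable.encode with hidx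
  have hinj : Function.Injective idx := Encodable.encode_injective
  have hDsub : Lam (r + m + 1) \ Lam (r + m) ⊆ Lam (r + m + 1) := Finset.sdiff_subset
  have hDc : ((Lam (r + m + 1) \ Lam (r + m)).card : ℝ) ≤ 16 * r := by
    have : (Lam (r + m + 1) \ Lam (r + m)).card = 8 * (r + m + 1) := by
      rw [Finset.card_sdiff_of_subset (Lam_mono (by omega)), card_Lam, card_Lam]
      apply Nat.sub_eq_of_eq_add
      ring
    rw [this]
    exact_mod_cast (by omega : 8 * (r + m + 1) ≤ 16 * r)
  obtain ⟨p, hp1, hp2, hTT⟩ := good_param Adjacent Star (Lam (r + m + 1)) (Lam (r + m + 1) \ Lam (r + m)) idx hDsub h0.le h12 h1.le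
  have hTb : 2 * ((Lam (r + m + 1) \ Lam (r + m)).card : ℝ) + 2 * ((Lam (r + m + 1) \ Lam (r + m)).card : ℝ) / (p2 - p1) ≤
      16 * r * (2 + 2 / (p2 - p1)) := by
    have h3 : 0 ≤ 2 + 2 / (p2 - p1) := by
      have : 0 < p2 - p1 := by linarith
      positivity
    have h4 := mul_le_mul_of_nonneg_right hDc h3
    calc _ = ((Lam (r + m + 1) \ Lam (r + m)).card : ℝ) * (2 + 2 / (p2 - p1)) := by ring
      _ ≤ _ := h4
  have nn : ∀ (R : ℤ × ℤ → ℤ × ℤ → Prop) (q : ℝ), 0 ≤ q → q ≤ 1 →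
      0 ≤ TT R (Lam (r + m + 1)) (Lam (r + m + 1) \ Lam (r + m)) idx q := by
    intro R q hq0 hq1
    apply Finset.sum_nonneg
    intro w hw
    exact drop_nonneg hq0 hq1 (Finset.mem_sdiff.1 hw).2
  have fin : ∀ (R : ℤ × ℤ → ℤ × ℤ → Prop) (q : ℝ), Nice R → c ≤ q → q ≤ 1 →
      TT R (Lam (r + m + 1)) (Lam (r + m + 1) \ Lam (r + m)) idx q ≤ 16 * r * (2 + 2 / (p2 - p1)) →
      E q (Lam (2 * r + m + 2)) (fun ω => ind (TwoX R m (2 * r + m + 2) 0 ω)) ≤ δ := by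
    intro R q hR hcq hq1 hT
    have hq0 : 0 ≤ q := hc0.le.trans hcq
    have ts := two_sum hR idx hinj hq0 hq1 m r
    set X := E q (Lam (2 * r + m + 2)) (fun ω => ind (TwoX R m (2 * r + m + 2) 0 ω)) with hX
    have hX0 : 0 ≤ X := E_nonneg hq0 hq1 _ (fun _ => ind_nonneg _)
    have e1 : M * TT R (Lam (r + m + 1)) (Lam (r + m + 1) \ Lam (r + m)) idx q ≤ 16 * r * K := by
      calc _ ≤ M * (16 * r * (2 + 2 / (p2 - p1))) := mul_le_mul_of_nonneg_left hT hM0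
        _ = _ := by rw [hK]; ring
    have e2 : c ^ (Lam m).card ≤ q ^ (Lam m).card := pow_le_pow_left₀ hc0.le hcq _
    have hrpos : (0 : ℝ) < r := by
      have : 0 < r := by omega
      exact_mod_cast this
    have e3 : (4 * (r : ℝ) ^ 2) * (c ^ (Lam m).card * X) ≤ ((2 * r + 1 : ℕ) : ℝ) ^ 2 * (q ^ (Lam m).card * X) := by
      apply mul_le_mul
      · push_cast; nlinarith
      · exact mul_le_mul_of_nonneg_right e2 hX0
      · positivity
      · positivity
    have e4 : (4 * (r : ℝ) ^ 2) * (c ^ (Lam m).card * X) ≤ 16 * r * K := e3.trans (ts.trans e1)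
    have e5 : 16 * r * K ≤ (4 * (r : ℝ) ^ 2) * (c ^ (Lam m).card * δ) := by
      have : 4 * (r:ℝ) * (4 * K) ≤ 4 * r * (δ' * r) := mul_le_mul_of_nonneg_left hr1 (by positivity)
      calc _ = 4 * (r:ℝ) * (4 * K) := by ring
        _ ≤ _ := this
        _ = _ := by rw [hδ']; ring
    have e6 := e4.trans e5
    have e7 : (0 : ℝ) < (4 * (r : ℝ) ^ 2) := by positivity
    have e8 : (0 : ℝ) < c ^ (Lam m).card := by positivity
    exact le_of_mul_le_mul_left (le_of_mul_le_mul_left e6 e7) e8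
  have n1 := nn Adjacent p (by linarith) (by linarith)
  have n2 := nn Star (1 - p) (by linarith) (by linarith)
  refine ⟨2 * r + m + 2, p, by omega, hp1, hp2, ?_, ?_⟩
  · exact fin Adjacent p nice_adj ((min_le_left _ _).trans hp1.le) (by linarith) (by linarith)
  · exact fin Star (1 - p) nice_star ((min_le_right _ _).trans (by linarith)) (by linarith) (by linarith)

end Perc

namespace Perc

/-! ### Sharpness: the closed star-clusters decay above criticality -/

lemma cross_prob {R : ℤ × ℤ → ℤ × ℤ → Prop} (hR : Nice R) {q : ℝ} (h0 : 0 ≤ q) (h1 : q ≤ 1) (m N : ℕ)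
    (hB : 1 - (1 / 10 : ℝ) ^ 4 ≤ E q (Lam N) (fun ω => ind (BoxArm R m N ω)))
    (hT : E q (Lam N) (fun ω => ind (TwoX R m N 0 ω)) ≤ 1 / 10)
    (f g : ℤ × ℤ → ℤ) (hf : f = f1 ∨ f = f2 ∨ f = f3 ∨ f = f4) (hg : g = f1 ∨ g = f2 ∨ g = f3 ∨ g = f4) :
    7 / 10 ≤ E q (Lam N) (fun ω => ind (∃ u v, f u = N ∧ g v = N ∧ Conn R (ω ∩ ↑(Lam N)) u v)) := by
  have s1 := sides hR h0 h1 m N hB f hf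
  have s2 := sides hR h0 h1 m N hB g hg
  have hbd : ∀ (f : ℤ × ℤ → ℤ), (f = f1 ∨ f = f2 ∨ f = f3 ∨ f = f4) → ∀ v ∈ Lam N, f v = N → v - 0 ∈ bd N := by
    rintro f (rfl | rfl | rfl | rfl) v hv he <;> refine ⟨by simpa using hv, ?_⟩ <;>
      simp only [f1, f2, f3, f4] at he <;> simp only [sub_zero] <;> omega
  have key : E q (Lam N) (fun ω => ind (SA R m N f ω) + ind (SA R m N g ω) - ind (TwoX R m N 0 ω)) ≤
      E q (Lam N) (fun ω => ind (∃ u v, f u = N ∧ g v = N ∧ Conn R (ω ∩ ↑(Lam N)) u v) + 1) := by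
    apply E_mono h0 h1
    intro ω _
    have a1 := ind_le_one (SA R m N f ω)
    have a2 := ind_le_one (SA R m N g ω)
    have a3 := ind_nonneg (TwoX R m N 0 ω)
    have a4 := ind_nonneg (∃ u v, f u = N ∧ g v = N ∧ Conn R (ω ∩ ↑(Lam N)) u v)
    by_cases A : SA R m N f ω
    · by_cases B : SA R m N g ω
      · by_cases C : TwoX R m N 0 ω
        · rw [ind_true C]; linarith
        · rw [ind_true (Q := ∃ u v, f u = N ∧ g v = N ∧ Conn R (ω ∩ ↑(Lam N)) u v)]
          · linarith
          obtain ⟨u, hu, a, ha, hfa, hua⟩ := A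
          obtain ⟨v, hv, b, hb, hgb, hvb⟩ := B
          refine ⟨a, b, hfa, hgb, ?_⟩
          by_contra hcon
          have hset : {w : ℤ × ℤ | w - 0 ∈ Lam N} = (↑(Lam N) : Set (ℤ × ℤ)) := by ext w; simp
          apply C
          refine ⟨u, v, a, b, by simpa using hu, by simpa using hv, hbd f hf a ha hfa, hbd g hg b hb hgb, ?_, ?_, ?_⟩ <;>
            rw [hset]
          · exact hua
          · exact hvb
          · intro huv
            exact hcon (((hua.symm hR.symm).trans huv).trans hvb)
      · rw [ind_false B]; linarith
    · rw [ind_false A]; linarith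
  rw [E_sub, E_add, E_add, E_const] at key
  linarith

theorem exists_S {p1 p : ℝ} (h0 : 0 < p1) (h : p1 < p) (h1 : p < 1) {c : ℝ} (hc : 0 < c)
    (hθ : ∀ n, c ≤ theta Adjacent n p1) : ∃ S : Finset (ℤ × ℤ), 0 ∈ S ∧ phi (1 - p) S < 1 := by
  by_contra hcon
  push Not at hcon
  set p2 := (p1 + p) / 2 with hp2
  have h12 : p1 < p2 := by rw [hp2]; linarith
  have h2p : p2 < p := by rw [hp2]; linarith
  have hd := dct (q1 := 1 - p) (q2 := 1 - p2) (by linarith) (by linarith) (by linarith) hcon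
  have hc' : 0 < 1 - Real.exp (-((1 - p2) - (1 - p)) / 9) := by
    rw [sub_pos, Real.exp_lt_one_iff]; linarith
  have hε : (0 : ℝ) < (1 / 10) ^ 4 := by positivity
  obtain ⟨m1, hm1⟩ := arms_to_one nice_adj h0.le (by linarith) hc hθ hε
  obtain ⟨m2, hm2⟩ := arms_to_one nice_star (by linarith) (by linarith) hc' hd hε
  set m := max m1 m2 with hm
  obtain ⟨N, q, hN, hq1, hq2, t1, t2⟩ := unique_scale m (δ := 1 / 10) (by norm_num) h0 h12 (by linarith)
  have up : ∀ (R : ℤ × ℤ → ℤ × ℤ → Prop) (m' : ℕ) (a b : ℝ), 0 ≤ a → a ≤ b → b ≤ 1 → m' ≤ m →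
      E a (Lam N) (fun ω => ind (BoxArm R m' N ω)) ≤ E b (Lam N) (fun ω => ind (BoxArm R m N ω)) := by
    intro R m' a b ha hab hb hmm
    refine le_trans (E_mono ha (by linarith) _ (G := fun ω => ind (BoxArm R m N ω)) ?_) (E_mono_p ha hab hb _ _ ?_)
    · intro ω _
      apply ind_mono
      rintro ⟨u, hu, v, hv, hcn⟩
      exact ⟨u, Lam_mono hmm hu, v, hv, hcn⟩
    · intro ω ω' hω
      exact ind_mono (fun hb => hb.mono hω)
  have b1 := (hm1 N ((le_max_left _ _).trans hN)).trans (up Adjacent m1 p1 q h0.le hq1.le (by linarith) (le_max_left _ _))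
  have b2 := (hm2 N ((le_max_right _ _).trans hN)).trans
    (up Star m2 (1 - p2) (1 - q) (by linarith) (by linarith) (by linarith) (le_max_right _ _))
  have c1 := cross_prob nice_adj (by linarith) (by linarith) m N b1 t1 f3 f1 (by tauto) (by tauto)
  have c2 := cross_prob nice_star (by linarith) (by linarith) m N b2 t2 f2 f4 (by tauto) (by tauto)
  rw [← E_compl q (Lam N) (fun ω => ind (∃ u v, f2 u = N ∧ f4 v = N ∧ Conn Star (ω ∩ ↑(Lam N)) u v))
    (dep_inter (fun ω => ind (∃ u v, f2 u = N ∧ f4 v = N ∧ Conn Star ω u v)) _)] at c2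
  have key : E q (Lam N) (fun ω => ind (∃ u v, f3 u = N ∧ f1 v = N ∧ Conn Adjacent (ω ∩ ↑(Lam N)) u v) +
      ind (∃ u v, f2 u = N ∧ f4 v = N ∧ Conn Star (ωᶜ ∩ ↑(Lam N)) u v)) ≤ E q (Lam N) (fun _ => 1) := by
    apply E_mono (by linarith) (by linarith)
    intro ω _
    by_cases A : ∃ u v, f3 u = N ∧ f1 v = N ∧ Conn Adjacent (ω ∩ ↑(Lam N)) u v
    · by_cases B : ∃ u v, f2 u = N ∧ f4 v = N ∧ Conn Star (ωᶜ ∩ ↑(Lam N)) u v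
      · exfalso
        obtain ⟨u, v, hu, hv, huv⟩ := A
        obtain ⟨z, t, hz, ht, hzt⟩ := B
        simp only [f1, f2, f3, f4] at hu hv hz ht
        refine not_both (-(N : ℤ)) N ω ↑(Lam N) ?_ huv (by omega) hv hzt (by omega) ht
        intro w hw
        rw [Finset.mem_coe, mem_Lam] at hw
        omega
      · rw [ind_false B]; linarith [ind_le_one (∃ u v, f3 u = N ∧ f1 v = N ∧ Conn Adjacent (ω ∩ ↑(Lam N)) u v)]
    · rw [ind_false A]; linarith [ind_le_one (∃ u v, f2 u = N ∧ f4 v = N ∧ Conn Star (ωᶜ ∩ ↑(Lam N)) u v)]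
  rw [E_add, E_const] at key
  linarith

end Perc

namespace Perc

/-! ### Crossing estimates -/

noncomputable def BB (n : ℕ) : Finset (ℤ × ℤ) := Finset.Icc (0, 0) ((n : ℤ), (n : ℤ))

lemma mem_BB {n : ℕ} {v : ℤ × ℤ} : v ∈ BB n ↔ 0 ≤ v.1 ∧ v.1 ≤ n ∧ 0 ≤ v.2 ∧ v.2 ≤ n := by
  simp only [BB, Finset.mem_Icc, Prod.le_def]; tauto

/-- Open left-right crossing. -/
def LR (n : ℕ) (ω : Set (ℤ × ℤ)) : Prop :=
  ∃ u v, u.1 = 0 ∧ v.1 = (n : ℤ) ∧ Conn Adjacent (ω ∩ ↑(BB n)) u v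

lemma LR.mono {n : ℕ} {ω ω' : Set (ℤ × ℤ)} (h : LR n ω) (hω : ω ⊆ ω') : LR n ω' := by
  obtain ⟨u, v, h1, h2, h3⟩ := h
  exact ⟨u, v, h1, h2, h3.mono (Set.inter_subset_inter_left _ hω)⟩

lemma lr_dep (n : ℕ) : Dep (LR n) ↑(BB n) :=
  dep_inter (fun ω => ∃ u v : ℤ × ℤ, u.1 = 0 ∧ v.1 = (n : ℤ) ∧ Conn Adjacent ω u v) _

lemma no_cross {q : ℝ} (h0 : 0 ≤ q) (h1 : q ≤ 1) (n : ℕ) :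
    E q (BB n) (fun ω => ind (¬ LR n ω)) ≤ (n + 1) * theta Star n (1 - q) := by
  have hsub : BB n ⊆ Lam (2 * n) := by
    intro v hv
    rw [mem_BB] at hv; rw [mem_Lam]; push_cast; omega
  have hdep : Dep (fun ω => ind (¬ LR n ω)) ↑(BB n) := by
    apply Dep.ind
    intro ω
    show (¬ LR n _) = (¬ LR n ω)
    rw [lr_dep n ω]
  rw [← E_dep q hsub _ hdep]
  have step : E q (Lam (2 * n)) (fun ω => ind (¬ LR n ω)) ≤
      E q (Lam (2 * n)) (fun ω => ∑ i ∈ Finset.range (n + 1), ind (Arm Star n ((i : ℤ), (n : ℤ)) ωᶜ)) := by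
    apply E_mono h0 h1
    intro ω _
    by_cases hL : LR n ω
    · rw [ind_false (not_not.2 hL)]
      exact Finset.sum_nonneg fun i _ => ind_nonneg _
    · rw [ind_true hL]
      obtain ⟨z, t, hzt, hz, ht⟩ := dual_crossing n ω ↑(BB n) (fun v => by rw [Finset.mem_coe, mem_BB])
        (fun u v huv hu hv => hL ⟨u, v, hu, hv, huv⟩)
      have hz1 := mem_BB.1 hzt.mem_left.2
      have ht1 := mem_BB.1 hzt.mem_right.2
      have hzi : (((z.1.toNat : ℕ) : ℤ), (n : ℤ)) = z := by
        ext
        · simp; omega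
        · simp [hz]
      have harm : Arm Star n (((z.1.toNat : ℕ) : ℤ), (n : ℤ)) ωᶜ := by
        rw [hzi]
        refine arm_of_conn (fun _ _ h => h) (hzt.mono Set.inter_subset_left) (Or.inr ⟨?_, ?_⟩)
        · rw [mem_Lam]; simp only [Prod.fst_sub, Prod.snd_sub]; omega
        · simp only [Prod.fst_sub, Prod.snd_sub]; omega
      have hmem : z.1.toNat ∈ Finset.range (n + 1) := by
        rw [Finset.mem_range]; omega
      have := Finset.single_le_sum (f := fun i : ℕ => ind (Arm Star n ((i : ℤ), (n : ℤ)) ωᶜ))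
        (fun i _ => ind_nonneg _) hmem
      rw [← ind_true harm]
      exact this
  refine step.trans ?_
  rw [E_sum]
  have each : ∀ i ∈ Finset.range (n + 1), E q (Lam (2 * n)) (fun ω => ind (Arm Star n ((i : ℤ), (n : ℤ)) ωᶜ)) =
      theta Star n (1 - q) := by
    intro i hi
    rw [Finset.mem_range] at hi
    have hs : LamT n ((i : ℤ), (n : ℤ)) ⊆ Lam (2 * n) := by
      intro v hv
      rw [mem_LamT, mem_Lam] at hv; rw [mem_Lam]
      simp only [Prod.fst_sub, Prod.snd_sub] at hv
      push_cast; omega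
    rw [E_compl q (Lam (2 * n)) (fun ω => ind (Arm Star n ((i : ℤ), (n : ℤ)) ω)), E_arm nice_star _ _ _ hs]
    refine (arm_dep Star n _).ind.mono ?_
    intro w hw
    exact hs (mem_LamT.2 hw)
  rw [Finset.sum_congr rfl each, Finset.sum_const, Finset.card_range, nsmul_eq_mul]
  push_cast
  exact le_rfl

lemma theta_anti {q : ℝ} (h0 : 0 ≤ q) (h1 : q ≤ 1) {n n' : ℕ} (h : n ≤ n') : theta Star n' q ≤ theta Star n q := by
  rw [← E_arm nice_star q n 0 (Λ := Lam n'), theta]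
  · apply E_mono h0 h1
    intro ω _
    apply ind_mono
    rintro ⟨v, hv, hc⟩
    refine arm_of_conn (fun _ _ h => h) (hc.mono Set.inter_subset_left) ?_
    rcases eq_or_lt_of_le h with rfl | h
    · exact Or.inr hv
    · left
      intro h3
      rw [mem_Lam] at h3
      have := hv.2
      omega
  · intro v hv
    rw [mem_LamT, sub_zero] at hv
    exact Lam_mono h hv

lemma exp_decay {q : ℝ} (h0 : 0 ≤ q) (h1 : q ≤ 1) (S : Finset (ℤ × ℤ)) (h0S : 0 ∈ S) (hphi : phi q S < 1) :
    ∃ a : ℝ, 0 < a ∧ ∃ n0 : ℕ, ∀ n : ℕ, n0 ≤ n → (n + 1) * theta Star n q ≤ Real.exp (-a * n) := by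
  obtain ⟨L, hL⟩ : ∃ L : ℕ, S ⊆ Lam L := by
    refine ⟨∑ v ∈ S, (v.1.natAbs + v.2.natAbs), ?_⟩
    intro v hv
    have := Finset.single_le_sum (f := fun v : ℤ × ℤ => v.1.natAbs + v.2.natAbs) (fun _ _ => Nat.zero_le _) hv
    rw [mem_Lam]
    omega
  set φ := max (phi q S) (1 / 2) with hφ
  have hφ0 : 0 < φ := lt_of_lt_of_le (by norm_num) (le_max_right _ _)
  have hφ1 : φ < 1 := max_lt hphi (by norm_num)
  have hphi0 : 0 ≤ phi q S := Finset.sum_nonneg fun x _ => Finset.sum_nonneg fun y _ =>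
    E_nonneg h0 h1 _ (fun _ => ind_nonneg _)
  set b := -Real.log φ / (L + 1) with hb
  have hlog : Real.log φ < 0 := Real.log_neg hφ0 hφ1
  have hL0 : (0 : ℝ) < L + 1 := by positivity
  have hb0 : 0 < b := div_pos (by linarith) hL0
  have th : ∀ n : ℕ, theta Star n q ≤ φ⁻¹ * Real.exp (-b * n) := by
    intro n
    have d1 := decay_pow h0 h1 S L hL h0S (n / (L + 1))
    have d2 := theta_anti h0 h1 (Nat.div_mul_le_self n (L + 1))
    have d3 : phi q S ^ (n / (L + 1)) ≤ φ ^ (n / (L + 1)) := pow_le_pow_left₀ hphi0 (le_max_left _ _) _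
    refine (d2.trans (d1.trans d3)).trans ?_
    have e1 : φ ^ (n / (L + 1)) = Real.exp (Real.log φ * ((n / (L + 1) : ℕ) : ℝ)) := by
      rw [mul_comm, ← Real.log_pow, Real.exp_log (by positivity)]
    have e2 : φ⁻¹ = Real.exp (-Real.log φ) := by rw [Real.exp_neg, Real.exp_log hφ0]
    rw [e1, e2, ← Real.exp_add]
    apply Real.exp_le_exp.2
    have e3 : (n : ℝ) ≤ (((n / (L + 1) : ℕ) : ℝ) + 1) * (L + 1) := by
      have := Nat.lt_div_mul_add (a := n) (b := L + 1) (by omega)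
      have h5 : n ≤ (n / (L + 1) + 1) * (L + 1) := by
        rw [Nat.add_mul, Nat.one_mul]; omega
      exact_mod_cast h5
    have e4 : -b * n = Real.log φ * (n / (L + 1)) := by rw [hb]; field_simp
    rw [e4]
    have e5 : (n : ℝ) / (L + 1) ≤ ((n / (L + 1) : ℕ) : ℝ) + 1 := by
      rw [div_le_iff₀ hL0]; exact e3
    nlinarith
  set ρ := Real.exp (-(b / 2)) with hρ
  have hρ0 : 0 < ρ := Real.exp_pos _
  have hρ1 : ρ < 1 := by rw [hρ, Real.exp_lt_one_iff]; linarith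
  have lim : Filter.Tendsto (fun n : ℕ => φ⁻¹ * ((n : ℝ) ^ 1 * ρ ^ n + ρ ^ n)) Filter.atTop (nhds (φ⁻¹ * (0 + 0))) := by
    apply Filter.Tendsto.const_mul
    apply Filter.Tendsto.add
    · exact tendsto_pow_const_mul_const_pow_of_abs_lt_one 1 (by rw [abs_of_pos hρ0]; exact hρ1)
    · exact tendsto_pow_atTop_nhds_zero_of_lt_one hρ0.le hρ1
  have ev := lim.eventually (gt_mem_nhds (show φ⁻¹ * (0 + 0) < 1 by simp))
  obtain ⟨n0, hn0⟩ := Filter.eventually_atTop.1 ev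
  refine ⟨b / 2, by linarith, n0, ?_⟩
  intro n hn
  have h3 := hn0 n hn
  have h4 : ρ ^ n = Real.exp (-(b / 2) * n) := by
    rw [hρ, ← Real.exp_nat_mul]; ring_nf
  have h5 : Real.exp (-b * n) = ρ ^ n * ρ ^ n := by
    rw [h4, ← Real.exp_add]; ring_nf
  calc ((n : ℝ) + 1) * theta Star n q ≤ (n + 1) * (φ⁻¹ * Real.exp (-b * n)) :=
        mul_le_mul_of_nonneg_left (th n) (by positivity)
    _ = (φ⁻¹ * ((n : ℝ) ^ 1 * ρ ^ n + ρ ^ n)) * ρ ^ n := by rw [h5]; ring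
    _ ≤ 1 * ρ ^ n := mul_le_mul_of_nonneg_right h3.le (by positivity)
    _ = _ := by rw [one_mul, h4]

/-- The crossings can be blocked with `k` closed sites. -/
def Few (n k : ℕ) (ω : Set (ℤ × ℤ)) : Prop := ∃ K : Finset (ℤ × ℤ), K.card ≤ k ∧ ¬ LR n (ω \ ↑K)

lemma few_dep (n k : ℕ) : Dep (Few n k) ↑(BB n) := by
  intro ω
  unfold Few
  have : ∀ K : Finset (ℤ × ℤ), LR n ((ω ∩ ↑(BB n)) \ ↑K) = LR n (ω \ ↑K) := by
    intro K
    apply (lr_dep n).congr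
    ext v; simp only [Set.mem_inter_iff, Set.mem_sdiff]; tauto
  simp only [this]

lemma E_superset {r : ℝ} (h0 : 0 ≤ r) (h1 : r ≤ 1) (S W : Finset (ℤ × ℤ)) (hW : W ⊆ S) :
    r ^ W.card ≤ E r S (fun ω => ind (↑W ⊆ ω)) := by
  have := E_union_le h0 h1 S W hW (fun ω => ind (↑W ⊆ ω)) (fun _ => ind_nonneg _)
  have h2 : E r S (fun ω => ind ((↑W : Set (ℤ × ℤ)) ⊆ ω ∪ ↑W)) = 1 := by
    rw [← E_const r S 1]
    apply E_congr
    intro ω _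
    exact ind_true Set.subset_union_right
  rw [h2, mul_one] at this
  exact this

lemma few_bound {p r : ℝ} (h0 : 0 ≤ p) (h1 : p ≤ 1) (hr0 : 0 ≤ r) (hr1 : r ≤ 1) (n k : ℕ) :
    (1 - r) ^ k * E p (BB n) (fun ω => ind (Few n k ω)) ≤ E (p * r) (BB n) (fun ω => ind (¬ LR n ω)) := by
  classical
  rw [E_coupling, ← E_mul_left]
  apply E_mono h0 h1
  intro ω hω
  by_cases hF : Few n k ω
  · rw [ind_true hF, mul_one]
    obtain ⟨K, hK, hL⟩ := hF
    set W := K ∩ BB n with hW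
    have hWc : W.card ≤ k := (Finset.card_le_card Finset.inter_subset_left).trans hK
    have s1 := E_superset (r := 1 - r) (by linarith) (by linarith) (BB n) W Finset.inter_subset_right
    rw [← E_compl r (BB n) (fun ω => ind (↑W ⊆ ω))] at s1
    · refine le_trans (pow_le_pow_of_le_one (by linarith) (by linarith) hWc) (s1.trans ?_)
      apply E_mono hr0 hr1
      intro η _
      apply ind_mono
      intro hη hLR
      refine hL (hLR.mono ?_)
      rintro v ⟨hv, hvη⟩
      refine ⟨hv, fun hvK => ?_⟩
      have : v ∈ (↑W : Set (ℤ × ℤ)) := by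
        rw [Finset.mem_coe, hW, Finset.mem_inter]; exact ⟨hvK, hω hv⟩
      exact hη this hvη
    · apply Dep.ind (Q := fun ω : Set (ℤ × ℤ) => (↑W : Set (ℤ × ℤ)) ⊆ ω)
      intro ω'
      apply propext
      constructor
      · exact fun h => h.trans Set.inter_subset_left
      · exact fun h v hv => ⟨h hv, (Finset.mem_inter.1 (Finset.mem_coe.1 hv)).2⟩
  · rw [ind_false hF, mul_zero]
    exact E_nonneg hr0 hr1 _ (fun _ => ind_nonneg _)

lemma lr_full (n : ℕ) (ω : Set (ℤ × ℤ)) (h : ↑(BB n) ⊆ ω) : LR n ω := by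
  have key : ∀ j : ℕ, j ≤ n → Conn Adjacent (ω ∩ ↑(BB n)) (0, 0) ((j : ℤ), 0) := by
    have hm : ∀ j : ℕ, j ≤ n → (((j : ℤ), 0) : ℤ × ℤ) ∈ ω ∩ ↑(BB n) := by
      intro j hj
      have : (((j : ℤ), 0) : ℤ × ℤ) ∈ BB n := by rw [mem_BB]; simp; omega
      exact ⟨h this, this⟩
    intro j
    induction j with
    | zero => intro hj; exact Conn.refl (hm 0 hj)
    | succ j ih =>
      intro hj
      refine (ih (by omega)).tail ?_ (hm _ hj)
      rw [adj_iff]; simp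
  exact ⟨(0, 0), ((n : ℤ), 0), rfl, rfl, key n le_rfl⟩

/-- The finite-volume form of the theorem. -/
theorem few_exp {p p' : ℝ} (hp'0 : 0 < p') (hp' : p' < p) (hp1 : p ≤ 1) (S : Finset (ℤ × ℤ)) (h0S : 0 ∈ S)
    (hphi : phi (1 - p') S < 1) :
    ∃ C₅ : ℝ, 0 < C₅ ∧ ∃ C₆ : ℝ, 0 < C₆ ∧ ∀ n k : ℕ, 1 ≤ n → (k : ℝ) ≤ C₅ * n →
      E p (BB n) (fun ω => ind (Few n k ω)) ≤ Real.exp (-C₆ * n) := by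
  obtain ⟨a, ha, n0, hn0⟩ := exp_decay (q := 1 - p') (by linarith) (by linarith) S h0S hphi
  have hp0 : 0 < p := by linarith
  set r := p' / p with hr
  have hr0 : 0 < r := div_pos hp'0 hp0
  have hr1 : r < 1 := (div_lt_one hp0).2 hp'
  have hpr : p * r = p' := by rw [hr]; field_simp
  set L := -Real.log (1 - r) with hL
  have hL0 : 0 < L := by
    have := Real.log_neg (x := 1 - r) (by linarith) (by linarith)
    rw [hL]; linarith
  set C5 := min (a / (2 * L)) (1 / (2 * ((n0 : ℝ) + 1))) with hC5
  have hC5a : C5 ≤ a / (2 * L) := min_le_left _ _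
  have hC5b : C5 ≤ 1 / (2 * ((n0 : ℝ) + 1)) := min_le_right _ _
  have hn0' : (0 : ℝ) < (n0 : ℝ) + 1 := by positivity
  set x := p ^ (BB n0).card with hx
  have hx0 : 0 < x := by positivity
  refine ⟨C5, lt_min (by positivity) (by positivity), min (a / 2) (x / ((n0 : ℝ) + 1)), lt_min (by positivity) (by positivity), ?_⟩
  intro n k hn hk
  have hnn : (0 : ℝ) ≤ n := by positivity
  rcases le_or_gt n0 n with hcase | hcase
  · have f1 := few_bound hp0.le hp1 hr0.le hr1.le n k
    rw [hpr] at f1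
    have f2 := (f1.trans (no_cross hp'0.le (by linarith) n)).trans (hn0 n hcase)
    have e1 : (1 - r) ^ k = Real.exp (-(L * k)) := by
      have : -(L * k) = Real.log ((1 - r) ^ k) := by rw [Real.log_pow, hL]; ring
      rw [this, Real.exp_log (pow_pos (by linarith) _)]
    rw [e1] at f2
    have e2 : E p (BB n) (fun ω => ind (Few n k ω)) ≤ Real.exp (L * k) * Real.exp (-a * n) := by
      calc _ = Real.exp (L * k) * (Real.exp (-(L * k)) * E p (BB n) (fun ω => ind (Few n k ω))) := by
            rw [← mul_assoc, ← Real.exp_add]; simp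
        _ ≤ _ := mul_le_mul_of_nonneg_left f2 (Real.exp_pos _).le
    refine e2.trans ?_
    rw [← Real.exp_add]
    apply Real.exp_le_exp.2
    have e3 : L * k ≤ a / 2 * n := by
      calc L * k ≤ L * (C5 * n) := mul_le_mul_of_nonneg_left hk hL0.le
        _ ≤ L * (a / (2 * L) * n) := mul_le_mul_of_nonneg_left (mul_le_mul_of_nonneg_right hC5a hnn) hL0.le
        _ = _ := by field_simp
    have e4 : min (a / 2) (x / ((n0 : ℝ) + 1)) * n ≤ a / 2 * n := mul_le_mul_of_nonneg_right (min_le_left _ _) hnn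
    linarith
  · have hnlt : (n : ℝ) < (n0 : ℝ) + 1 := by
      have : n < n0 + 1 := by omega
      exact_mod_cast this
    have hk0 : k = 0 := by
      have h3 : (k : ℝ) < 1 := by
        calc (k : ℝ) ≤ C5 * n := hk
          _ ≤ 1 / (2 * ((n0 : ℝ) + 1)) * n := mul_le_mul_of_nonneg_right hC5b hnn
          _ = (n / ((n0 : ℝ) + 1)) / 2 := by field_simp
          _ < 1 := by
            have := (div_lt_one hn0').2 hnlt
            linarith
      have : k < 1 := by exact_mod_cast h3
      omega
    subst hk0
    have g1 : E p (BB n) (fun ω => ind (Few n 0 ω)) ≤ 1 - x := by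
      have s1 := E_superset hp0.le hp1 (BB n) (BB n) (Finset.Subset.refl _)
      have s2 : x ≤ p ^ (BB n).card := by
        apply pow_le_pow_of_le_one hp0.le hp1
        apply Finset.card_le_card
        intro v hv
        rw [mem_BB] at *; omega
      have s3 : E p (BB n) (fun ω => ind (Few n 0 ω)) ≤ E p (BB n) (fun ω => 1 - ind (↑(BB n) ⊆ ω)) := by
        apply E_mono hp0.le hp1
        intro ω _
        rw [← ind_not]
        apply ind_mono
        rintro ⟨K, hK, hL⟩ hsub
        rw [Nat.le_zero, Finset.card_eq_zero] at hK
        subst hK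
        apply hL
        simpa using lr_full n ω hsub
      rw [E_sub, E_const] at s3
      linarith
    refine g1.trans (le_trans ?_ (Real.exp_le_exp.2 (show -x ≤ _ from ?_)))
    · linarith [Real.add_one_le_exp (-x)]
    · have e4 : min (a / 2) (x / ((n0 : ℝ) + 1)) * n ≤ x / ((n0 : ℝ) + 1) * n := mul_le_mul_of_nonneg_right (min_le_right _ _) hnn
      have e5 : x / ((n0 : ℝ) + 1) * n ≤ x := by
        rw [div_mul_eq_mul_div, div_le_iff₀ hn0']
        exact mul_le_mul_of_nonneg_left hnlt.le hx0.le
      linarith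

end Perc

namespace Perc

/-! ### The measure-theoretic bridge -/

/-- The set of open sites. -/
def opn (ω : Config) : Set (ℤ × ℤ) := {v | ω v = true}

lemma cyl_meas (S : Finset (ℤ × ℤ)) (f : (ℤ × ℤ) → Bool) : MeasurableSet {ω : Config | ∀ v ∈ S, ω v = f v} := by
  have : {ω : Config | ∀ v ∈ S, ω v = f v} = ⋂ v ∈ S, (fun ω : Config => ω v) ⁻¹' {f v} := by
    ext ω; simp
  rw [this]
  exact Finset.measurableSet_biInter _ (fun v _ => (measurable_pi_apply v) (measurableSet_singleton _))

open Classical in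
lemma bridge {p : ℝ} (h0 : 0 ≤ p) (h1 : p ≤ 1) {μ : Measure Config} (hμ : IsBernoulliProduct p μ)
    (S : Finset (ℤ × ℤ)) (Q : Set (ℤ × ℤ) → Prop) (hQ : Dep Q ↑S) :
    μ {ω | Q (opn ω)} = ENNReal.ofReal (E p S (fun ω => ind (Q ω))) := by
  have hset : {ω : Config | Q (opn ω)} =
      ⋃ A ∈ S.powerset.filter (fun A : Finset (ℤ × ℤ) => Q (↑A : Set (ℤ × ℤ))),
        {ω : Config | ∀ v ∈ S, ω v = decide (v ∈ A)} := by
    ext ω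
    simp only [Set.mem_iUnion, Finset.mem_filter, Finset.mem_powerset, exists_prop]
    constructor
    · intro h
      refine ⟨S.filter (fun v => ω v = true), ⟨Finset.filter_subset _ _, ?_⟩, ?_⟩
      · have h2 : Q (opn ω) := h
        rw [← hQ] at h2
        convert h2 using 1
        ext v; simp [opn, and_comm]
      · intro v hv
        simp [hv]
    · rintro ⟨A, ⟨hA, hQA⟩, hω⟩
      show Q (opn ω)
      rw [← hQ]
      convert hQA using 1
      ext v
      constructor
      · rintro ⟨h2, h3⟩
        have h4 := hω v h3
        have h5 : ω v = true := h2
        rw [h5] at h4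
        simpa using h4.symm
      · intro h2
        refine ⟨?_, hA h2⟩
        show ω v = true
        rw [hω v (hA h2)]
        simpa using h2
  rw [hset, measure_biUnion_finset]
  · have hE : E p S (fun ω => ind (Q ω)) =
        ∑ A ∈ S.powerset.filter (fun A : Finset (ℤ × ℤ) => Q (↑A : Set (ℤ × ℤ))), p ^ A.card * (1 - p) ^ (S \ A).card := by
      rw [E, Finset.sum_filter]
      apply Finset.sum_congr rfl
      intro A _
      by_cases h : Q (↑A : Set (ℤ × ℤ))
      · rw [ind_true h, if_pos h, mul_one]
      · rw [ind_false h, if_neg h, mul_zero]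
    have h1p : 0 ≤ 1 - p := by linarith
    rw [hE, ENNReal.ofReal_sum_of_nonneg]
    · apply Finset.sum_congr rfl
      intro A hA
      rw [Finset.mem_filter, Finset.mem_powerset] at hA
      rw [hμ.2 S (fun v => decide (v ∈ A)), ← ENNReal.ofReal_prod_of_nonneg]
      · congr 1
        rw [← Finset.prod_sdiff hA.1]
        rw [Finset.prod_congr rfl (g := fun _ => 1 - p), Finset.prod_congr rfl (s₁ := A) (g := fun _ => p)]
        · rw [Finset.prod_const, Finset.prod_const, mul_comm]
        · intro v hv; simp [hv]
        · intro v hv; simp [(Finset.mem_sdiff.1 hv).2]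
      · intro v _
        split_ifs <;> assumption
    · intro A _
      positivity
  · intro A hA B hB hAB
    rw [Function.onFun, Set.disjoint_left]
    intro ω hωA hωB
    apply hAB
    simp only [Finset.coe_filter, Finset.mem_powerset] at hA hB
    ext v
    constructor
    · intro hv
      have e1 := hωA v (hA.1 hv)
      have e2 := hωB v (hA.1 hv)
      rw [e1] at e2
      simpa [hv] using e2
    · intro hv
      have e1 := hωA v (hB.1 hv)
      have e2 := hωB v (hB.1 hv)
      rw [e1] at e2
      simpa [hv] using e2
  · intro A _
    exact cyl_meas _ _

lemma pc_nonneg : 0 ≤ siteCriticalProbability := by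
  apply Real.sSup_nonneg
  rintro x ⟨hx, _⟩
  exact hx.1

lemma theta_pos {q : ℝ} (h : siteCriticalProbability < q) (h1 : q ≤ 1) :
    ∃ c : ℝ, 0 < c ∧ ∀ n, c ≤ theta Adjacent n q := by
  have h0 : 0 ≤ q := pc_nonneg.trans h.le
  have hnot : ¬ (q ∈ Set.Icc (0 : ℝ) 1 ∧ ∀ μ : Measure Config, IsBernoulliProduct q μ →
      μ {ω | (cluster ω Set.univ (0, 0)).Infinite} = 0) := by
    intro hq
    have : q ≤ siteCriticalProbability := by
      apply le_csSup
      · exact ⟨1, fun x hx => hx.1.2⟩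
      · exact hq
    linarith
  have hnot2 : ∃ μ : Measure Config, IsBernoulliProduct q μ ∧ μ {ω | (cluster ω Set.univ (0, 0)).Infinite} ≠ 0 := by
    by_contra hcon
    push Not at hcon
    exact hnot ⟨⟨h0, h1⟩, hcon⟩
  obtain ⟨μ, hμ, hpos⟩ := hnot2
  have := hμ.1
  refine ⟨(μ {ω | (cluster ω Set.univ (0, 0)).Infinite}).toReal, ENNReal.toReal_pos hpos (measure_ne_top _ _), ?_⟩
  intro n
  have hdep : Dep (Arm Adjacent n 0) ↑(Lam n) := (arm_dep Adjacent n 0).mono (by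
    intro w hw; simpa using hw)
  have br := bridge h0 h1 hμ (Lam n) (Arm Adjacent n 0) hdep
  apply ENNReal.toReal_le_of_le_ofReal (theta_nonneg _ _ h0 h1)
  rw [theta, ← br]
  apply measure_mono
  intro ω hω
  have hinf : (cluster ω Set.univ (0, 0)).Infinite := hω
  obtain ⟨w, hw, hwn⟩ := hinf.exists_notMem_finset (Lam n)
  obtain ⟨_, ho, hc⟩ := hw
  show Arm Adjacent n 0 (opn ω)
  have hconn : Conn Adjacent (opn ω) 0 w := by
    refine ⟨ho, ?_⟩
    exact Relation.ReflTransGen.mono (fun a b hab => And.intro hab.1 hab.2.2) _ _ hc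
  exact arm_of_conn nice_adj.star hconn (Or.inl (by simpa using hwn))

lemma few_of_not (ω : Config) (n k : ℕ) (h : ¬ HasDisjointCrossings ω n (k + 1)) : Few n k (opn ω) := by
  classical
  by_contra hF
  apply h
  obtain ⟨P, hP, hdisj⟩ := menger Adjacent ((BB n).filter (fun v => ω v = true)) {v | v.1 = 0} {v | v.1 = (n : ℤ)} (k + 1) (by
    intro K hK
    have hL : LR n (opn ω \ ↑K) := by
      by_contra hL
      exact hF ⟨K, by omega, hL⟩
    obtain ⟨u, v, hu, hv, huv⟩ := hL
    refine ⟨u, v, hu, hv, huv.mono ?_⟩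
    rintro w ⟨⟨h1, h2⟩, h3⟩
    refine ⟨?_, h2⟩
    rw [Finset.mem_coe, Finset.mem_filter]
    exact ⟨h3, h1⟩)
  refine ⟨P, fun i => ?_, hdisj⟩
  obtain ⟨h1, h2, h3, ⟨a, h4, h4'⟩, ⟨b, h5, h5'⟩⟩ := hP i
  refine ⟨h1, h2, ?_, ⟨a, h4, h4'⟩, ⟨b, h5, h5'⟩⟩
  intro v hv
  have := h3 v hv
  rw [Finset.mem_filter, mem_BB] at this
  exact this

theorem main (p : ℝ) (hpc : siteCriticalProbability < p) (hp1 : p ≤ 1)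
    (μ : Measure Config) (hμ : IsBernoulliProduct p μ) :
    ∃ C₅ : ℝ, 0 < C₅ ∧ ∃ C₆ : ℝ, 0 < C₆ ∧ ∀ n : ℕ, 1 ≤ n →
      μ {ω | ∀ k : ℕ, HasDisjointCrossings ω n k → (k : ℝ) ≤ C₅ * n} ≤
        ENNReal.ofReal (Real.exp (-C₆ * n)) := by
  have hc0 := pc_nonneg
  obtain ⟨p', hp'1, hp'2⟩ := exists_between hpc
  obtain ⟨p1, hp11, hp12⟩ := exists_between hp'1
  obtain ⟨c, hc, hθ⟩ := theta_pos hp11 (by linarith)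
  obtain ⟨S, h0S, hS⟩ := exists_S (by linarith) hp12 (by linarith) hc hθ
  obtain ⟨C5, hC5, C6, hC6, hb⟩ := few_exp (p := p) (by linarith) hp'2 hp1 S h0S hS
  refine ⟨C5, hC5, C6, hC6, fun n hn => ?_⟩
  have hfl : ((⌊C5 * n⌋₊ : ℕ) : ℝ) ≤ C5 * n := Nat.floor_le (by positivity)
  have hb' := hb n ⌊C5 * n⌋₊ hn hfl
  have br := bridge (by linarith) hp1 hμ (BB n) (Few n ⌊C5 * n⌋₊) (few_dep n _)
  refine le_trans (measure_mono ?_) (br.le.trans (ENNReal.ofReal_le_ofReal hb'))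
  intro ω hω
  apply few_of_not
  intro hcr
  have h2 := hω _ hcr
  have h3 := Nat.lt_floor_add_one (C5 * n)
  push_cast at h2
  linarith

end Perc

/-- Consider site percolation on `ℤ²` with parameter `p` satisfying
`p_c < p ≤ 1`. Let `M_n` be the maximal number of pairwise vertex-disjoint open left-right
crossings of the box `{0,…,n} × {0,…,n}`. Then there exist constants `C₅ = C₅(p) > 0` and
`C₆ = C₆(p) > 0` such that for all integers `n ≥ 1`, `P_p(M_n ≤ C₅·n) ≤ exp(−C₆·n)`.
(The event `M_n ≤ C₅·n` is expressed as: every `k` for which there exist `k` pairwise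
disjoint open crossings satisfies `k ≤ C₅·n`.) -/
theorem disjoint_crossings_bound (p : ℝ) (hpc : siteCriticalProbability < p) (hp1 : p ≤ 1)
    (μ : Measure Config) (hμ : IsBernoulliProduct p μ) :
    ∃ C₅ : ℝ, 0 < C₅ ∧ ∃ C₆ : ℝ, 0 < C₆ ∧ ∀ n : ℕ, 1 ≤ n →
      μ {ω | ∀ k : ℕ, HasDisjointCrossings ω n k → (k : ℝ) ≤ C₅ * n} ≤
        ENNReal.ofReal (Real.exp (-C₆ * n)) := by
  exact Perc.main p hpc hp1 μ hμ
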